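/- arXiv:2106.02955 — 2 statements merged into one kernel-verified Lean document; each statement's English description precedes it below -/
import Mathlib

section
/- Let I = I_a(F^b) be the generalized star configuration ideal. Then for all positive integers ℓ and m, one has the Demailly-like bound α(I^{(ℓ)})/ℓ ≥ (α(I^{(m)}) + h − 1)/(m + h − 1), where α(J) denotes the least degree of a nonzero form in a homogeneous ideal J. -/
open MvPolynomial

/-- The `N`-th symbolic power of an ideal `I`:
`I^{(N)} = ⋂_{p ∈ Ass(R/I)} (I^N R_p ∩ R)`, where `I^N R_p ∩ R` is the preimage in `R` of
the image of `I^N` under the localization map `R → R_p`. -/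
noncomputable def symbolicPower {R : Type*} [CommRing R] (I : Ideal R) (N : ℕ) : Ideal R :=
  ⨅ (p : Ideal R) (hp : p ∈ associatedPrimes R (R ⧸ I)),
    haveI : p.IsPrime := hp.isPrime
    Ideal.comap (algebraMap R (Localization.AtPrime p))
      (Ideal.map (algebraMap R (Localization.AtPrime p)) (I ^ N))

/-- The generalized star configuration ideal (uniform `a`-fold product ideal)
`I_a(F^b) = ⟨f₁^{n₁} ⋯ f_s^{n_s} : 0 ≤ nᵢ ≤ b, ∑ nᵢ = a⟩`. -/
noncomputable def afoldIdeal {R : Type*} [CommRing R] {s : ℕ} (f : Fin s → R) (a b : ℕ) :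
    Ideal R :=
  Ideal.span {g | ∃ e : Fin s → ℕ, (∀ i, e i ≤ b) ∧ (∑ i, e i) = a ∧ g = ∏ i, f i ^ e i}

/-- The least degree `α(J)` of a nonzero form in a homogeneous ideal `J`. -/
noncomputable def homAlpha {K : Type*} [Field K] {σ : Type*}
    (J : Ideal (MvPolynomial σ K)) : ℕ :=
  sInf {e : ℕ | ∃ g ∈ J, g ≠ 0 ∧ MvPolynomial.IsHomogeneous g e}

/-- The ideal generated by `J` and by all products `∏ i ∈ U, f i ^ e i` of total degree `a`
whose exponents are bounded by the caps `b`. -/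
def cappedIdeal {R ι : Type*} [CommRing R] (f : ι → R) (J : Ideal R) (U : Finset ι)
    (b : ι → ℕ) (a : ℕ) : Ideal R :=
  J ⊔ Ideal.span {g | ∃ e : ι → ℕ, (∀ i ∈ U, e i ≤ b i) ∧ ∑ i ∈ U, e i = a ∧
    g = ∏ i ∈ U, f i ^ e i}

section CappedIdeal

variable {R ι : Type*} [CommRing R] {f : ι → R} {J : Ideal R} {U : Finset ι}
  {b : ι → ℕ} {a : ℕ}

theorem prod_mem_cappedIdeal {e : ι → ℕ} (he : ∀ i ∈ U, e i ≤ b i) (hs : ∑ i ∈ U, e i = a) :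
    ∏ i ∈ U, f i ^ e i ∈ cappedIdeal f J U b a :=
  Ideal.mem_sup_right (Ideal.subset_span ⟨e, he, hs, rfl⟩)

theorem le_cappedIdeal : J ≤ cappedIdeal f J U b a := le_sup_left

theorem cappedIdeal_le {L : Ideal R} (hJ : J ≤ L)
    (h : ∀ e : ι → ℕ, (∀ i ∈ U, e i ≤ b i) → ∑ i ∈ U, e i = a → ∏ i ∈ U, f i ^ e i ∈ L) :
    cappedIdeal f J U b a ≤ L := by
  refine sup_le hJ (Ideal.span_le.2 ?_)
  rintro _ ⟨e, he, hs, rfl⟩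
  exact h e he hs

theorem cappedIdeal_zero : cappedIdeal f J U b 0 = ⊤ := by
  rw [Ideal.eq_top_iff_one]
  have := prod_mem_cappedIdeal (f := f) (J := J) (U := U) (b := b) (e := 0) (a := 0)
    (by simp) (by simp)
  simpa using this

theorem cappedIdeal_eq_of_sum_lt (h : ∑ i ∈ U, b i < a) : cappedIdeal f J U b a = J := by
  refine le_antisymm (cappedIdeal_le le_rfl fun e he hs => ?_) le_cappedIdeal
  have := Finset.sum_le_sum he
  omega

/-- `r` is a nonzerodivisor modulo the ideal `J`. -/
def IsRegularMod (J : Ideal R) (r : R) : Prop :=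
  ∀ x, r * x ∈ J → x ∈ J

/-- Modulo `J`, any at most `N` members of the family `f` indexed by `U` form a regular sequence,
in any order. -/
def IsGenericMod (f : ι → R) (J : Ideal R) (U : Finset ι) (N : ℕ) : Prop :=
  ∀ S ⊆ U, S.card < N → ∀ j ∈ U, j ∉ S → IsRegularMod (J ⊔ Ideal.span (f '' S)) (f j)

theorem IsGenericMod.mono {V : Finset ι} {M N : ℕ} (h : IsGenericMod f J U N) (hV : V ⊆ U)
    (hM : M ≤ N) : IsGenericMod f J V M :=
  fun S hS hc j hj hjS => h S (hS.trans hV) (hc.trans_le hM) j (hV hj) hjS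

theorem IsRegularMod.mul {r t : R} (hr : IsRegularMod J r) (ht : IsRegularMod J t) :
    IsRegularMod J (r * t) :=
  fun x hx => ht x (hr _ (by rwa [← mul_assoc]))

theorem IsRegularMod.prod {V : Finset ι} {g : ι → R} (h : ∀ i ∈ V, IsRegularMod J (g i)) :
    IsRegularMod J (∏ i ∈ V, g i) :=
  Finset.prod_induction _ _ (fun _ _ => IsRegularMod.mul) (fun x hx => by simpa using hx) h

theorem IsRegularMod.pow {r : R} (h : IsRegularMod J r) (k : ℕ) : IsRegularMod J (r ^ k) := by
  induction k with
  | zero => exact fun x hx => by simpa using hx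
  | succ k ih => rw [pow_succ]; exact ih.mul h

variable [DecidableEq ι]

theorem cappedIdeal_erase_le (i : ι) :
    cappedIdeal f J (U.erase i) b a ≤ cappedIdeal f J U b a := by
  by_cases hi : i ∈ U
  swap
  · rw [Finset.erase_eq_of_notMem hi]
  refine cappedIdeal_le le_cappedIdeal fun e he hs => ?_
  have := prod_mem_cappedIdeal (f := f) (J := J) (U := U) (b := b) (a := a)
    (e := Function.update e i 0) ?_ ?_
  · rw [← Finset.mul_prod_erase _ _ hi] at this
    simp only [Function.update_self, pow_zero, one_mul] at this
    convert this using 1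
    refine Finset.prod_congr rfl fun j hj => ?_
    rw [Function.update_of_ne (Finset.ne_of_mem_erase hj)]
  · intro j hj
    by_cases hji : j = i
    · subst hji; simp
    · rw [Function.update_of_ne hji]
      exact he j (Finset.mem_erase.2 ⟨hji, hj⟩)
  · rw [← Finset.add_sum_erase _ _ hi, ← hs, Function.update_self, zero_add]
    refine Finset.sum_congr rfl fun j hj => ?_
    rw [Function.update_of_ne (Finset.ne_of_mem_erase hj)]

theorem cappedIdeal_le_sup_span_erase {i : ι} (hi : i ∈ U) :
    cappedIdeal f J U b a ≤ cappedIdeal f (J ⊔ Ideal.span {f i}) (U.erase i) b a := by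
  refine cappedIdeal_le (le_sup_left.trans le_cappedIdeal) fun e he hs => ?_
  rcases Nat.eq_zero_or_pos (e i) with h0 | h0
  · rw [← Finset.mul_prod_erase _ _ hi, h0, pow_zero, one_mul]
    refine prod_mem_cappedIdeal (fun j hj => he j (Finset.mem_of_mem_erase hj)) ?_
    rw [← hs, ← Finset.add_sum_erase _ _ hi, h0, zero_add]
  · refine le_cappedIdeal (Ideal.mem_sup_right (Ideal.mem_span_singleton.2 ?_))
    exact (dvd_pow_self _ h0.ne').trans (Finset.dvd_prod_of_mem _ hi)

theorem cappedIdeal_sup_span_erase_le (i : ι) :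
    cappedIdeal f (J ⊔ Ideal.span {f i}) (U.erase i) b a ≤
      Ideal.span {f i} ⊔ cappedIdeal f J (U.erase i) b a := by
  unfold cappedIdeal
  refine sup_le (sup_le ?_ le_sup_left) ?_
  · exact le_sup_left.trans le_sup_right
  · exact le_sup_right.trans le_sup_right

theorem mul_mem_cappedIdeal {i : ι} (hi : i ∈ U) (hb : 1 ≤ b i) {y : R}
    (hy : y ∈ cappedIdeal f J U (Function.update b i (b i - 1)) a) :
    f i * y ∈ cappedIdeal f J U b (a + 1) := by
  suffices H : cappedIdeal f J U (Function.update b i (b i - 1)) a ≤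
      Submodule.comap (LinearMap.mulLeft R (f i)) (cappedIdeal f J U b (a + 1)) from H hy
  refine cappedIdeal_le (fun x hx => le_cappedIdeal (J.mul_mem_left _ hx)) fun e he hs => ?_
  have := prod_mem_cappedIdeal (f := f) (J := J) (U := U) (b := b) (a := a + 1)
    (e := Function.update e i (e i + 1)) ?_ ?_
  · change f i * _ ∈ cappedIdeal f J U b (a + 1)
    convert this using 1
    rw [← Finset.mul_prod_erase _ _ hi, ← Finset.mul_prod_erase U _ hi, Function.update_self,
      pow_succ', mul_assoc]
    congr 2
    refine Finset.prod_congr rfl fun j hj => ?_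
    rw [Function.update_of_ne (Finset.ne_of_mem_erase hj)]
  · intro j hj
    have := he j hj
    by_cases hji : j = i
    · subst hji
      simp only [Function.update_self] at this ⊢
      omega
    · rwa [Function.update_of_ne hji] at this ⊢
  · rw [← hs, ← Finset.add_sum_erase _ _ hi, ← Finset.add_sum_erase U e hi, Function.update_self,
      Finset.sum_congr rfl (g := fun j => e j) fun j hj => by
        rw [Function.update_of_ne (Finset.ne_of_mem_erase hj)]]
    ring

theorem exists_sub_mul_mem_cappedIdeal_erase {i : ι} (hi : i ∈ U) {x : R}
    (hx : x ∈ cappedIdeal f J U b (a + 1)) :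
    ∃ u ∈ cappedIdeal f J U (Function.update b i (b i - 1)) a,
      x - f i * u ∈ cappedIdeal f J (U.erase i) b (a + 1) := by
  suffices H : cappedIdeal f J U b (a + 1) ≤
      Submodule.map (LinearMap.mulLeft R (f i))
        (cappedIdeal f J U (Function.update b i (b i - 1)) a) ⊔
        cappedIdeal f J (U.erase i) b (a + 1) by
    obtain ⟨_, ⟨u, hu, rfl⟩, v, hv, rfl⟩ := Submodule.mem_sup.1 (H hx)
    exact ⟨u, hu, by simpa using hv⟩
  refine cappedIdeal_le (le_cappedIdeal.trans le_sup_right) fun e he hs => ?_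
  rcases Nat.eq_zero_or_pos (e i) with h0 | h0
  · refine Submodule.mem_sup_right ?_
    rw [← Finset.mul_prod_erase _ _ hi, h0, pow_zero, one_mul]
    refine prod_mem_cappedIdeal (fun j hj => he j (Finset.mem_of_mem_erase hj)) ?_
    rw [← hs, ← Finset.add_sum_erase _ _ hi, h0, zero_add]
  · refine Submodule.mem_sup_left
      ⟨_, prod_mem_cappedIdeal (e := Function.update e i (e i - 1)) ?_ ?_, ?_⟩
    · intro j hj
      by_cases hji : j = i
      · subst hji
        have := he j hj
        simp only [Function.update_self]
        omega
      · simpa [Function.update_of_ne hji] using he j hj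
    · rw [← Finset.add_sum_erase _ _ hi] at hs ⊢
      rw [Function.update_self, Finset.sum_congr rfl (g := fun j => e j) fun j hj => by
        rw [Function.update_of_ne (Finset.ne_of_mem_erase hj)]]
      omega
    · rw [LinearMap.mulLeft_apply, ← Finset.mul_prod_erase _ _ hi, ← Finset.mul_prod_erase U _ hi,
        Function.update_self, ← mul_assoc, ← pow_succ', Nat.sub_add_cancel h0]
      congr 1
      refine Finset.prod_congr rfl fun j hj => ?_
      rw [Function.update_of_ne (Finset.ne_of_mem_erase hj)]

theorem cappedIdeal_erase_succ_le (i : ι) :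
    cappedIdeal f J (U.erase i) b (a + 1) ≤
      cappedIdeal f J U (Function.update b i (b i - 1)) a := by
  refine le_trans ?_ (cappedIdeal_erase_le i)
  refine cappedIdeal_le le_cappedIdeal fun e he hs => ?_
  obtain ⟨k, hk, hk0⟩ : ∃ k ∈ U.erase i, e k ≠ 0 := by
    by_contra! hcon
    rw [Finset.sum_eq_zero hcon] at hs
    omega
  have hmem := prod_mem_cappedIdeal (f := f) (J := J) (U := U.erase i)
    (b := Function.update b i (b i - 1)) (a := a) (e := Function.update e k (e k - 1)) ?_ ?_
  · convert Ideal.mul_mem_left _ (f k) hmem using 1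
    rw [← Finset.mul_prod_erase _ _ hk, ← Finset.mul_prod_erase (U.erase i) _ hk,
      Function.update_self, ← mul_assoc, ← pow_succ',
      Nat.sub_add_cancel (Nat.one_le_iff_ne_zero.2 hk0)]
    congr 1
    refine Finset.prod_congr rfl fun j hj => ?_
    rw [Function.update_of_ne (Finset.ne_of_mem_erase hj)]
  · intro j hj
    have := he j hj
    rw [Function.update_of_ne (Finset.ne_of_mem_erase hj)]
    by_cases hjk : j = k
    · subst hjk
      simp only [Function.update_self]
      omega
    · rwa [Function.update_of_ne hjk]
  · rw [← Finset.add_sum_erase _ _ hk] at hs ⊢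
    rw [Function.update_self, Finset.sum_congr rfl (g := fun j => e j) fun j hj => by
      rw [Function.update_of_ne (Finset.ne_of_mem_erase hj)]]
    omega

theorem sup_span_singleton_sup_span_image (i : ι) (S : Finset ι) :
    J ⊔ Ideal.span {f i} ⊔ Ideal.span (f '' S) = J ⊔ Ideal.span (f '' (insert i S : Finset ι)) := by
  rw [Finset.coe_insert, Set.image_insert_eq, Ideal.span_insert, sup_assoc]

theorem IsGenericMod.erase {N : ℕ} (h : IsGenericMod f J U (N + 1)) {i : ι} (hi : i ∈ U) :
    IsGenericMod f (J ⊔ Ideal.span {f i}) (U.erase i) N := by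
  intro S hS hc j hj hjS
  rw [sup_span_singleton_sup_span_image]
  refine h _ (Finset.insert_subset hi (hS.trans (Finset.erase_subset _ _))) ?_ j
    (Finset.mem_of_mem_erase hj) ?_
  · exact (Finset.card_insert_le _ _).trans_lt (Nat.succ_lt_succ hc)
  · simp [Finset.ne_of_mem_erase hj, hjS]

theorem mem_of_mul_mem_cappedIdeal {i : ι} (hi : i ∈ U)
    (h : IsRegularMod (cappedIdeal f J (U.erase i) b (a + 1)) (f i)) {x : R}
    (hx : f i * x ∈ cappedIdeal f J U b (a + 1)) :
    x ∈ cappedIdeal f J U (Function.update b i (b i - 1)) a := by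
  obtain ⟨u, hu, hv⟩ := exists_sub_mul_mem_cappedIdeal_erase hi hx
  rw [← mul_sub] at hv
  have := cappedIdeal_erase_succ_le i (h _ hv)
  simpa using add_mem this hu

theorem isRegularMod_cappedIdeal {N : ℕ} {r : R} (hN : ∑ i ∈ U, b i < a + N)
    (hf : IsGenericMod f J U N)
    (hr : ∀ S ⊆ U, S.card ≤ N → ∑ i ∈ U \ S, b i < a →
      IsRegularMod (J ⊔ Ideal.span (f '' S)) r) :
    IsRegularMod (cappedIdeal f J U b a) r := by
  induction hn : U.card + ∑ i ∈ U, b i using Nat.strong_induction_on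
    generalizing J U b a N r with
  | _ n ih =>
  subst hn
  by_cases hlt : ∑ i ∈ U, b i < a
  · rw [cappedIdeal_eq_of_sum_lt hlt]
    simpa using hr ∅ (by simp) (by simp) (by simpa using hlt)
  rcases a with _ | a
  · rw [cappedIdeal_zero]
    exact fun x _ => trivial
  rcases N with _ | N
  · exact absurd hN hlt
  obtain ⟨i, hi, hbi⟩ : ∃ i ∈ U, 1 ≤ b i := by
    by_contra! hcon
    refine hlt ?_
    rw [Finset.sum_eq_zero fun i hi => by have := hcon i hi; omega]
    omega
  have hsum : b i + ∑ j ∈ U.erase i, b j = ∑ j ∈ U, b j := Finset.add_sum_erase _ _ hi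
  have hcard : (U.erase i).card + 1 = U.card := Finset.card_erase_add_one hi
  have hsdiff : ∀ S : Finset ι, U.erase i \ S = U \ insert i S := by
    intro S
    rw [Finset.sdiff_insert, Finset.erase_sdiff_comm]
  intro x hx
  have h1 : IsRegularMod (cappedIdeal f (J ⊔ Ideal.span {f i}) (U.erase i) b (a + 1)) r := by
    refine ih _ (by omega) (N := N) (by omega) (hf.erase hi) (fun S hS hc hlt => ?_) rfl
    rw [sup_span_singleton_sup_span_image]
    refine hr _ (Finset.insert_subset hi (hS.trans (Finset.erase_subset _ _)))
      ((Finset.card_insert_le _ _).trans (Nat.succ_le_succ hc)) ?_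
    rwa [← hsdiff]
  have h2 : IsRegularMod (cappedIdeal f J (U.erase i) b (a + 1)) (f i) := by
    refine ih _ (by omega) (N := N) (by omega)
      (hf.mono (Finset.erase_subset _ _) (Nat.le_succ _)) (fun S hS hc hlt => ?_) rfl
    exact hf S (hS.trans (Finset.erase_subset _ _)) (Nat.lt_succ_of_le hc) i hi
      fun h => Finset.notMem_erase i U (hS h)
  have h3 : IsRegularMod (cappedIdeal f J U (Function.update b i (b i - 1)) a) r := by
    have hle : ∀ j, Function.update b i (b i - 1) j ≤ b j := by
      intro j
      by_cases hji : j = i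
      · subst hji; simp
      · rw [Function.update_of_ne hji]
    have hupd : ∀ V : Finset ι, i ∈ V →
        ∑ j ∈ V, Function.update b i (b i - 1) j + 1 = ∑ j ∈ V, b j := by
      intro V hV
      rw [← Finset.add_sum_erase _ _ hV, ← Finset.add_sum_erase V b hV, Function.update_self,
        Finset.sum_congr rfl (g := fun j => b j) fun j hj => by
          rw [Function.update_of_ne (Finset.ne_of_mem_erase hj)]]
      omega
    have := hupd U hi
    refine ih _ (by omega) (N := N + 1) (by omega) hf (fun S hS hc hlt => hr S hS hc ?_) rfl
    by_cases hiS : i ∈ U \ S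
    · have := hupd _ hiS
      omega
    · rw [Finset.sum_congr rfl (g := fun j => b j) fun j hj => by
        rw [Function.update_of_ne (ne_of_mem_of_not_mem hj hiS)]] at hlt
      omega
  obtain ⟨_, hy, v, hv, rfl⟩ := Submodule.mem_sup.1
    (cappedIdeal_sup_span_erase_le i (h1 x (cappedIdeal_le_sup_span_erase hi hx)))
  obtain ⟨y, rfl⟩ := Ideal.mem_span_singleton.1 hy
  have hv' := cappedIdeal_erase_le i hv
  refine add_mem (mul_mem_cappedIdeal hi hbi (h3 y (mem_of_mul_mem_cappedIdeal hi h2 ?_))) hv'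
  have := sub_mem hx (Ideal.mul_mem_left _ r hv')
  convert this using 1
  ring

theorem cappedIdeal_eq_sup_span_pow (hb : ∀ i ∈ U, a ≤ b i) :
    cappedIdeal f J U b a = J ⊔ Ideal.span (f '' U) ^ a := by
  refine le_antisymm (cappedIdeal_le le_sup_left fun e _ hs => ?_) (sup_le le_cappedIdeal ?_)
  · refine Ideal.mem_sup_right ?_
    rw [← hs, ← Finset.prod_pow_eq_pow_sum]
    exact Ideal.prod_mem_prod fun i hi =>
      Ideal.pow_mem_pow (Ideal.subset_span (Set.mem_image_of_mem f hi)) _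
  · suffices H : Ideal.span (f '' U) ^ a ≤ cappedIdeal f J U (fun _ => a) a by
      refine H.trans (cappedIdeal_le le_cappedIdeal fun e he hs => ?_)
      exact prod_mem_cappedIdeal (fun i hi => (he i hi).trans (hb i hi)) hs
    clear hb
    induction a with
    | zero => rw [cappedIdeal_zero]; exact le_top
    | succ a ih =>
      rw [pow_succ']
      refine Ideal.mul_le.2 fun x hx y hy => ?_
      suffices H : Ideal.span (f '' U) ≤ Submodule.comap (LinearMap.mulRight R y)
          (cappedIdeal f J U (fun _ => a + 1) (a + 1)) from H hx
      refine Ideal.span_le.2 ?_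
      rintro _ ⟨i, hi, rfl⟩
      refine mul_mem_cappedIdeal hi (by simp) ?_
      refine cappedIdeal_le le_cappedIdeal (fun e he hs => prod_mem_cappedIdeal ?_ hs) (ih hy)
      intro j hj
      by_cases hji : j = i
      · subst hji; simpa using he j hj
      · rw [Function.update_of_ne hji]; exact (he j hj).trans (Nat.le_succ _)

theorem isRegularMod_sup_span_pow {r : R} (hf : IsGenericMod f J U U.card)
    (hr : IsRegularMod (J ⊔ Ideal.span (f '' U)) r) :
    IsRegularMod (J ⊔ Ideal.span (f '' U) ^ a) r := by
  rw [← cappedIdeal_eq_sup_span_pow (b := fun _ => a) fun _ _ => le_rfl]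
  refine isRegularMod_cappedIdeal (N := U.card * a + 1) (by simp; omega)
    (fun S hS _ j hj hjS => hf S hS (Finset.card_lt_card ⟨hS, fun h => hjS (h hj)⟩) j hj hjS)
    fun S hS _ hlt => ?_
  rcases (U \ S).eq_empty_or_nonempty with h0 | h0
  · rwa [hS.antisymm (Finset.sdiff_eq_empty_iff_subset.1 h0)]
  · have := Nat.mul_le_mul_right a h0.card_pos
    simp only [Finset.sum_const, smul_eq_mul] at hlt
    omega

theorem mem_sup_span_pow_of_mul_mem {i : ι} (hi : i ∈ U) (hf : IsGenericMod f J U U.card) {x : R}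
    (hx : f i * x ∈ J ⊔ Ideal.span (f '' U) ^ (a + 1)) :
    x ∈ J ⊔ Ideal.span (f '' U) ^ a := by
  rw [← cappedIdeal_eq_sup_span_pow (b := fun _ => a + 1) fun _ _ => le_rfl] at hx
  have hcard := Finset.card_erase_lt_of_mem hi
  have := mem_of_mul_mem_cappedIdeal hi ?_ hx
  · rwa [cappedIdeal_eq_sup_span_pow] at this
    intro j hj
    by_cases hji : j = i
    · subst hji; simp
    · rw [Function.update_of_ne hji]; omega
  · rw [cappedIdeal_eq_sup_span_pow fun _ _ => le_rfl]
    exact isRegularMod_sup_span_pow (hf.mono (Finset.erase_subset _ _) hcard.le)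
      (hf _ (Finset.erase_subset _ _) hcard i hi (Finset.notMem_erase i U))

theorem mem_sup_span_pow_of_prod_mul_mem (hf : IsGenericMod f J U U.card) (V : Finset ι)
    (hV : V ⊆ U) {x : R} (hx : (∏ i ∈ V, f i) * x ∈ J ⊔ Ideal.span (f '' U) ^ a) :
    x ∈ J ⊔ Ideal.span (f '' U) ^ (a - V.card) := by
  induction V using Finset.induction_on generalizing a with
  | empty => simpa using hx
  | insert i V hi ih =>
    rw [Finset.prod_insert hi, mul_assoc] at hx
    have hiU := hV (Finset.mem_insert_self i V)
    rw [Finset.card_insert_of_notMem hi]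
    rcases a with _ | a
    · simp
    · have := ih ((Finset.subset_insert _ _).trans hV) (mem_sup_span_pow_of_mul_mem hiU hf hx)
      rwa [show a + 1 - (V.card + 1) = a - V.card by omega]

theorem mem_sup_span_pow_of_prod_pow_mul_mem (hf : IsGenericMod f J U U.card) (k : ℕ) {x : R}
    (hx : (∏ i ∈ U, f i) ^ k * x ∈ J ⊔ Ideal.span (f '' U) ^ a) :
    x ∈ J ⊔ Ideal.span (f '' U) ^ (a - k * U.card) := by
  induction k generalizing a with
  | zero => simpa using hx
  | succ k ih =>
    rw [pow_succ', mul_assoc] at hx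
    have := ih (mem_sup_span_pow_of_prod_mul_mem hf U le_rfl hx)
    rwa [Nat.sub_sub, show U.card + k * U.card = (k + 1) * U.card by ring] at this

theorem IsGenericMod.sup_span {M N : ℕ} (h : IsGenericMod f J U (M + N)) {S V : Finset ι}
    (hS : S ⊆ U) (hSM : S.card ≤ M) (hV : V ⊆ U) (hd : Disjoint S V) :
    IsGenericMod f (J ⊔ Ideal.span (f '' S)) V N := by
  intro S' hS' hc j hj hjS
  rw [sup_assoc, ← Ideal.span_union, ← Set.image_union, ← Finset.coe_union]
  refine h _ (Finset.union_subset hS (hS'.trans hV)) ?_ j (hV hj) ?_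
  · have := Finset.card_union_le S S'
    omega
  · simp [hjS, Finset.disjoint_right.1 hd hj]

end CappedIdeal

section Noetherian

variable {R : Type*} [CommRing R]

theorem isRegularMod_iff_isSMulRegular {J : Ideal R} {r : R} :
    IsRegularMod J r ↔ IsSMulRegular (R ⧸ J) r := by
  rw [isSMulRegular_iff_right_eq_zero_of_smul]
  constructor
  · intro h x hx
    obtain ⟨x, rfl⟩ := Ideal.Quotient.mk_surjective x
    refine Ideal.Quotient.eq_zero_iff_mem.2 (h x ?_)
    rw [← Ideal.Quotient.eq_zero_iff_mem, map_mul]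
    simpa [Algebra.smul_def] using hx
  · intro h x hx
    refine Ideal.Quotient.eq_zero_iff_mem.1 (h _ ?_)
    rw [← Ideal.Quotient.eq_zero_iff_mem, map_mul] at hx
    simpa [Algebra.smul_def] using hx

theorem associatedPrimes_subset_of_mul {J L : Ideal R} (u : R) (h : ∀ x, u * x ∈ L ↔ x ∈ J) :
    associatedPrimes R (R ⧸ J) ⊆ associatedPrimes R (R ⧸ L) := by
  have hle : J ≤ Submodule.comap (LinearMap.mulLeft R u) L := fun x hx => (h x).2 hx
  refine associatedPrimes.subset_of_injective
    (f := Submodule.mapQ J L (LinearMap.mulLeft R u) hle) ?_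
  rw [← LinearMap.ker_eq_bot, LinearMap.ker_eq_bot']
  intro x hx
  obtain ⟨x, rfl⟩ := Submodule.Quotient.mk_surjective _ x
  rw [Submodule.mapQ_apply, Submodule.Quotient.mk_eq_zero] at hx
  exact (Submodule.Quotient.mk_eq_zero _).2 ((h x).1 hx)

variable [IsNoetherianRing R]

theorem IsRegularMod.notMem_associatedPrime {J : Ideal R} {r : R} (hr : IsRegularMod J r)
    {q : Ideal R} (hq : q ∈ associatedPrimes R (R ⧸ J)) : r ∉ q := by
  intro hrq
  have : r ∈ ⋃ p ∈ associatedPrimes R (R ⧸ J), (p : Set R) := Set.mem_biUnion hq hrq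
  rw [biUnion_associatedPrimes_eq_compl_regular] at this
  exact this (isRegularMod_iff_isSMulRegular.1 hr)

theorem exists_isRegularMod_of_not_le {𝒥 : Set (Ideal R)} (h𝒥 : 𝒥.Finite) {C : Ideal R}
    (hC : ∀ J ∈ 𝒥, ∀ q ∈ associatedPrimes R (R ⧸ J), ¬ C ≤ q) :
    ∃ r ∈ C, ∀ J ∈ 𝒥, IsRegularMod J r := by
  by_contra! hcon
  have hsub : (C : Set R) ⊆ ⋃ q ∈ ⋃ J ∈ 𝒥, associatedPrimes R (R ⧸ J), (q : Set R) := by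
    intro r hr
    obtain ⟨J, hJ, hJr⟩ := hcon r hr
    have : r ∈ ⋃ p ∈ associatedPrimes R (R ⧸ J), (p : Set R) := by
      rw [biUnion_associatedPrimes_eq_compl_regular]
      exact fun h => hJr (isRegularMod_iff_isSMulRegular.2 h)
    obtain ⟨q, hq, hrq⟩ := Set.mem_iUnion₂.1 this
    exact Set.mem_biUnion (Set.mem_biUnion hJ hq) hrq
  obtain ⟨q, hq, hCq⟩ := (Ideal.subset_union_prime_finite
    (h𝒥.biUnion fun J _ => associatedPrimes.finite R (R ⧸ J)) (f := id) ⊤ ⊤ (fun q hq _ _ => by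
      obtain ⟨J, -, hq⟩ := Set.mem_iUnion₂.1 hq
      exact hq.isPrime)).1 hsub
  obtain ⟨J, hJ, hq⟩ := Set.mem_iUnion₂.1 hq
  exact hC J hJ q hq hCq

end Noetherian

theorem mem_symbolicPower_iff {R : Type*} [CommRing R] {I : Ideal R} {N : ℕ} {x : R} :
    x ∈ symbolicPower I N ↔
      ∀ p ∈ associatedPrimes R (R ⧸ I), ∃ u, u ∉ p ∧ u * x ∈ I ^ N := by
  simp only [symbolicPower, Ideal.mem_iInf, Ideal.mem_comap]
  refine forall₂_congr fun p hp => ?_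
  have : p.IsPrime := hp.isPrime
  rw [IsLocalization.algebraMap_mem_map_algebraMap_iff p.primeCompl]
  rfl

section StarConfiguration

variable {R : Type*} [CommRing R] {s : ℕ} {f : Fin s → R} {a b h : ℕ}

theorem isGenericMod_of_isRegular
    (hgen : ∀ l : List (Fin s), l.Nodup → l.length ≤ h + 1 →
      RingTheory.Sequence.IsRegular R (l.map f)) :
    IsGenericMod f ⊥ Finset.univ (h + 1) := by
  intro S _ hS j _ hj
  have hreg := (hgen (S.toList ++ [j]) ?_ ?_).toIsWeaklyRegular
  · rw [List.map_append, RingTheory.Sequence.isWeaklyRegular_append_iff] at hreg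
    have h2 := hreg.2
    rw [List.map_singleton, RingTheory.Sequence.isWeaklyRegular_singleton_iff,
      smul_eq_mul, Ideal.mul_top, ← isRegularMod_iff_isSMulRegular] at h2
    convert h2 using 1
    rw [bot_sup_eq, Ideal.ofList]
    congr 1
    ext x
    simp
  · simpa [List.nodup_append, S.nodup_toList] using fun a ha (haj : a = j) => hj (haj ▸ ha)
  · simpa using hS

theorem afoldIdeal_eq_cappedIdeal :
    afoldIdeal f a b = cappedIdeal f ⊥ Finset.univ (fun _ => b) a := by
  simp [afoldIdeal, cappedIdeal]

theorem afoldIdeal_le_span_pow (hb : 0 < b) (ha : a + h = b * s + 1) {T : Finset (Fin s)}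
    (hT : T.card = h) : afoldIdeal f a b ≤ Ideal.span (f '' T) ^ ((b - 1) * h + 1) := by
  rw [afoldIdeal_eq_cappedIdeal]
  refine cappedIdeal_le bot_le fun e he hs => ?_
  rw [← Finset.prod_mul_prod_compl T]
  refine Ideal.mul_mem_right _ _ (Ideal.pow_le_pow_right (n := ∑ i ∈ T, e i) ?_ ?_)
  · have h1 : ∑ i ∈ Tᶜ, e i ≤ Tᶜ.card * b :=
      Finset.sum_le_card_nsmul _ _ _ fun i _ => he i (Finset.mem_univ i)
    have h2 := Finset.sum_add_sum_compl T e
    have h3 := T.card_add_card_compl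
    rw [Fintype.card_fin, hT] at h3
    obtain ⟨b, rfl⟩ : ∃ b', b = b' + 1 := ⟨b - 1, by omega⟩
    rw [hs] at h2
    rw [← h3] at ha
    simp only [Nat.add_sub_cancel]
    nlinarith
  · rw [← Finset.prod_pow_eq_pow_sum]
    exact Ideal.prod_mem_prod fun i hi =>
      Ideal.pow_mem_pow (Ideal.subset_span (Set.mem_image_of_mem f hi)) _

theorem isRegularMod_span_image (hf : IsGenericMod f ⊥ Finset.univ (h + 1)) {T : Finset (Fin s)}
    (hT : T.card ≤ h) {j : Fin s} (hj : j ∉ T) : IsRegularMod (Ideal.span (f '' T)) (f j) := by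
  simpa using hf T (Finset.subset_univ _) (by omega) j (Finset.mem_univ _) hj

theorem mul_mem_afoldIdeal_iff (hf : IsGenericMod f ⊥ Finset.univ (h + 1)) (hb : 0 < b)
    (ha : a + h = b * s + 1) (ha0 : 0 < a) {T : Finset (Fin s)} (hT : T.card = h) (x : R) :
    (∏ i, f i ^ (if i ∈ T then b - 1 else b)) * x ∈ afoldIdeal f a b ↔
      x ∈ Ideal.span (f '' T) := by
  have hprod : ∏ i, f i ^ (if i ∈ T then b - 1 else b) =
      (∏ i ∈ T, f i) ^ (b - 1) * ∏ i ∈ Tᶜ, f i ^ b := by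
    rw [← Finset.prod_mul_prod_compl T, ← Finset.prod_pow]
    congr 1
    · exact Finset.prod_congr rfl fun i hi => by rw [if_pos hi]
    · exact Finset.prod_congr rfl fun i hi => by rw [if_neg (Finset.mem_compl.1 hi)]
  have hfT : IsGenericMod f ⊥ T T.card := hf.mono (Finset.subset_univ _) (by omega)
  constructor
  · intro hx
    have h1 := afoldIdeal_le_span_pow hb ha hT hx
    rw [hprod, mul_comm (_ ^ _), mul_assoc] at h1
    have h2 : IsRegularMod (⊥ ⊔ Ideal.span (f '' T) ^ ((b - 1) * h + 1)) (∏ i ∈ Tᶜ, f i ^ b) := by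
      refine IsRegularMod.prod fun i hi => IsRegularMod.pow (isRegularMod_sup_span_pow hfT ?_) b
      rw [bot_sup_eq]
      exact isRegularMod_span_image hf hT.le (Finset.mem_compl.1 hi)
    have h3 := mem_sup_span_pow_of_prod_pow_mul_mem hfT _ (h2 _ (by rwa [bot_sup_eq]))
    rwa [hT, Nat.add_sub_cancel_left, pow_one, bot_sup_eq] at h3
  · intro hx
    suffices H : Ideal.span (f '' T) ≤ Submodule.comap
        (LinearMap.mulLeft R (∏ i, f i ^ (if i ∈ T then b - 1 else b))) (afoldIdeal f a b) from
      H hx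
    refine Ideal.span_le.2 ?_
    rintro _ ⟨j, hj, rfl⟩
    have hj' : j ∈ T := hj
    obtain ⟨a, rfl⟩ : ∃ a', a = a' + 1 := ⟨a - 1, by omega⟩
    change _ * f j ∈ afoldIdeal f (a + 1) b
    rw [mul_comm, afoldIdeal_eq_cappedIdeal]
    refine mul_mem_cappedIdeal (Finset.mem_univ j) hb (prod_mem_cappedIdeal (fun i _ => ?_) ?_)
    · by_cases hij : i = j
      · subst hij; simp [hj']
      · rw [Function.update_of_ne hij]
        split_ifs <;> omega
    · rw [← Finset.sum_add_sum_compl T, Finset.sum_congr rfl (g := fun _ => b - 1) fun i hi => by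
        rw [if_pos hi], Finset.sum_congr (s₁ := Tᶜ) rfl (g := fun _ => b) fun i hi => by
        rw [if_neg (Finset.mem_compl.1 hi)]]
      have h3 := T.card_add_card_compl
      rw [Fintype.card_fin, hT] at h3
      simp only [Finset.sum_const, smul_eq_mul, hT]
      obtain ⟨b, rfl⟩ : ∃ b', b = b' + 1 := ⟨b - 1, by omega⟩
      rw [← h3] at ha
      simp only [Nat.add_sub_cancel]
      nlinarith

variable [IsNoetherianRing R]

theorem card_le_of_mem_associatedPrimes (hf : IsGenericMod f ⊥ Finset.univ (h + 1))
    (ha : b * s < a + h) {p : Ideal R} (hp : p ∈ associatedPrimes R (R ⧸ afoldIdeal f a b))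
    {T : Finset (Fin s)} (hT : ∀ i ∈ T, f i ∈ p) : T.card ≤ h := by
  by_contra! hlt
  have hmem : ∃ r ∈ p, ∀ J ∈ (fun S : Finset (Fin s) => Ideal.span (f '' S)) '' {S | S.card ≤ h},
      IsRegularMod J r := by
    refine exists_isRegularMod_of_not_le (Set.toFinite _) ?_
    rintro _ ⟨S, hS, rfl⟩ q hq hpq
    have hS' : S.card ≤ h := hS
    obtain ⟨j, hjT, hjS⟩ : ∃ j ∈ T, j ∉ S := by
      by_contra! hcon
      have := Finset.card_le_card hcon
      omega
    exact (isRegularMod_span_image hf hS' hjS).notMem_associatedPrime hq (hpq (hT j hjT))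
  obtain ⟨r, hrp, hr⟩ := hmem
  refine IsRegularMod.notMem_associatedPrime (r := r) ?_ hp hrp
  rw [afoldIdeal_eq_cappedIdeal]
  refine isRegularMod_cappedIdeal (N := h) (by simpa [mul_comm] using ha)
    (hf.mono le_rfl (Nat.le_succ h)) fun S _ hS _ => ?_
  rw [bot_sup_eq]
  exact hr _ ⟨S, hS, rfl⟩

theorem symbolicPower_afoldIdeal_le_span_pow (hf : IsGenericMod f ⊥ Finset.univ (h + 1))
    (hb : 0 < b) (ha : a + h = b * s + 1) (ha0 : 0 < a) {T : Finset (Fin s)} (hT : T.card = h)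
    (l : ℕ) :
    symbolicPower (afoldIdeal f a b) l ≤ Ideal.span (f '' T) ^ (l * ((b - 1) * h + 1)) := by
  intro g hg
  have hmem : ∃ r ∈ Submodule.comap (LinearMap.mulRight R g)
      (Ideal.span (f '' T) ^ (l * ((b - 1) * h + 1))),
      ∀ J ∈ ({Ideal.span (f '' T)} : Set (Ideal R)), IsRegularMod J r := by
    refine exists_isRegularMod_of_not_le (Set.finite_singleton _) ?_
    rintro _ rfl q hq hCq
    obtain ⟨u, huq, hu⟩ := mem_symbolicPower_iff.1 hg q
      (associatedPrimes_subset_of_mul _ (mul_mem_afoldIdeal_iff hf hb ha ha0 hT) hq)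
    refine huq (hCq ?_)
    have := Ideal.pow_right_mono (afoldIdeal_le_span_pow (f := f) hb ha hT) l hu
    rwa [← pow_mul, mul_comm _ l] at this
  obtain ⟨r, hrC, hr⟩ := hmem
  have hfT : IsGenericMod f ⊥ T T.card := hf.mono (Finset.subset_univ _) (by omega)
  have := isRegularMod_sup_span_pow (a := l * ((b - 1) * h + 1)) (r := r) hfT
    (by rw [bot_sup_eq]; exact hr _ rfl)
  rw [bot_sup_eq] at this
  exact this g hrC

end StarConfiguration

section Upper

theorem exists_sum_eq_of_sum_le_of_le_sum {ι : Type*} [DecidableEq ι] (U : Finset ι)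
    {lo hi : ι → ℕ} (hle : ∀ i ∈ U, lo i ≤ hi i) {a : ℕ} (hlo : ∑ i ∈ U, lo i ≤ a)
    (hhi : a ≤ ∑ i ∈ U, hi i) :
    ∃ e : ι → ℕ, (∀ i ∈ U, lo i ≤ e i ∧ e i ≤ hi i) ∧ ∑ i ∈ U, e i = a := by
  induction U using Finset.induction_on generalizing a with
  | empty => exact ⟨0, by simp, by simp at hhi ⊢; omega⟩
  | insert i U hi' ih =>
    rw [Finset.sum_insert hi'] at hlo hhi
    have h1 := hle i (Finset.mem_insert_self i U)
    have h2 : ∑ j ∈ U, lo j ≤ ∑ j ∈ U, hi j :=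
      Finset.sum_le_sum fun j hj => hle j (Finset.mem_insert_of_mem hj)
    obtain ⟨e, he, hs⟩ := ih (fun j hj => hle j (Finset.mem_insert_of_mem hj))
      (a := a - max (lo i) (a - ∑ j ∈ U, hi j)) (by omega) (by omega)
    have hne : ∀ j ∈ U, j ≠ i := fun j hj => ne_of_mem_of_not_mem hj hi'
    refine ⟨Function.update e i (max (lo i) (a - ∑ j ∈ U, hi j)), ?_, ?_⟩
    · intro j hj
      rcases Finset.mem_insert.1 hj with rfl | hj
      · rw [Function.update_self]; omega
      · rw [Function.update_of_ne (hne j hj)]; exact he j hj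
    · rw [Finset.sum_insert hi', Function.update_self,
        Finset.sum_congr rfl fun j hj => Function.update_of_ne (hne j hj) _ e, hs]
      omega

variable {R : Type*} [CommRing R] {s : ℕ} {f : Fin s → R} {a b h : ℕ}

theorem prod_mem_afoldIdeal_pow_of_sum_eq {m : ℕ} {N : Fin s → ℕ} (hN : ∀ i, N i ≤ m * b)
    (hs : ∑ i, N i = m * a) : ∏ i, f i ^ N i ∈ afoldIdeal f a b ^ m := by
  induction m generalizing N with
  | zero => simp
  | succ m ih =>
    have hlohi : ∀ i ∈ Finset.univ, N i - m * b ≤ min b (N i) := by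
      intro i _
      have := hN i
      have : (m + 1) * b = m * b + b := by ring
      omega
    have hlo : ∑ i, (N i - m * b) ≤ a := by
      refine Nat.le_of_mul_le_mul_left (c := m + 1) ?_ m.succ_pos
      rw [← hs, Finset.mul_sum]
      refine Finset.sum_le_sum fun i _ => ?_
      have h1 := hN i
      rcases le_total (N i) (m * b) with h2 | h2
      · simp [Nat.sub_eq_zero_of_le h2]
      · obtain ⟨c, hc⟩ := Nat.exists_eq_add_of_le h2
        rw [hc] at h1 ⊢
        rw [Nat.add_sub_cancel_left]
        nlinarith
    have hhi : a ≤ ∑ i, min b (N i) := by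
      refine Nat.le_of_mul_le_mul_left (c := m + 1) ?_ m.succ_pos
      rw [← hs, Finset.mul_sum]
      refine Finset.sum_le_sum fun i _ => ?_
      have h1 := hN i
      rcases le_total b (N i) with h2 | h2
      · rwa [min_eq_left h2]
      · rw [min_eq_right h2]
        nlinarith
    obtain ⟨e, he, hes⟩ := exists_sum_eq_of_sum_le_of_le_sum Finset.univ hlohi hlo hhi
    have hadd : ∑ i, (N i - e i) + ∑ i, e i = ∑ i, N i := by
      rw [← Finset.sum_add_distrib]
      refine Finset.sum_congr rfl fun i hi => Nat.sub_add_cancel ?_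
      exact (he i hi).2.trans (min_le_right _ _)
    have h1 := ih (N := fun i => N i - e i)
      (fun i => by have := (he i (Finset.mem_univ i)).1; omega)
      (by have : (m + 1) * a = m * a + a := by ring
          omega)
    have h2 : ∏ i, f i ^ e i ∈ afoldIdeal f a b :=
      Ideal.subset_span ⟨e, fun i => (he i (Finset.mem_univ i)).2.trans (min_le_left _ _),
        hes, rfl⟩
    rw [pow_succ]
    convert Ideal.mul_mem_mul h1 h2 using 1
    rw [← Finset.prod_mul_distrib]
    refine Finset.prod_congr rfl fun i hi => ?_
    rw [← pow_add, Nat.sub_add_cancel ((he i hi).2.trans (min_le_right _ _))]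

theorem prod_mem_afoldIdeal_pow {m : ℕ} {N : Fin s → ℕ} (hN : ∀ i, N i ≤ m * b)
    (hs : m * a ≤ ∑ i, N i) : ∏ i, f i ^ N i ∈ afoldIdeal f a b ^ m := by
  obtain ⟨e, he, hes⟩ := exists_sum_eq_of_sum_le_of_le_sum Finset.univ (lo := 0) (hi := N)
    (by simp) (by simp) hs
  have h1 := prod_mem_afoldIdeal_pow_of_sum_eq (f := f) (a := a) (b := b) (N := e)
    (fun i => (he i (Finset.mem_univ i)).2.trans (hN i)) hes
  refine Ideal.mem_of_dvd _ (Finset.prod_dvd_prod_of_dvd _ _ fun i hi => ?_) h1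
  exact pow_dvd_pow _ (he i hi).2

theorem prod_mem_symbolicPower [IsNoetherianRing R] (hf : IsGenericMod f ⊥ Finset.univ (h + 1))
    (hb : 0 < b) (ha : a + h = b * s + 1) {m : ℕ} {v : Fin s → ℕ} (hv : ∀ i, v i ≤ m)
    (hsum : ∀ T : Finset (Fin s), T.card = h → m ≤ ∑ i ∈ T, v i) :
    ∏ i, f i ^ (m * (b - 1) + v i) ∈ symbolicPower (afoldIdeal f a b) m := by
  classical
  rw [mem_symbolicPower_iff]
  intro p hp
  have hprime : p.IsPrime := hp.isPrime
  obtain ⟨T, hT⟩ : ∃ T : Finset (Fin s), ∀ i, i ∈ T ↔ f i ∈ p :=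
    ⟨Finset.univ.filter fun i => f i ∈ p, by simp⟩
  have hcard : T.card ≤ h :=
    card_le_of_mem_associatedPrimes hf (by omega) hp fun i hi => (hT i).1 hi
  refine ⟨∏ i ∈ Tᶜ, f i ^ (m - v i), fun hmem => ?_, ?_⟩
  · obtain ⟨i, hi, hip⟩ := (hprime.prod_mem_iff).1 hmem
    exact Finset.mem_compl.1 hi ((hT i).2 (hprime.mem_of_pow_mem _ hip))
  obtain ⟨b, rfl⟩ : ∃ b', b = b' + 1 := ⟨b - 1, by omega⟩
  simp only [Nat.add_sub_cancel]
  have hN := prod_mem_afoldIdeal_pow (f := f) (a := a) (b := b + 1) (m := m)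
    (N := fun i => if i ∈ T then m * b + v i else m * (b + 1)) ?_ ?_
  · convert hN using 1
    rw [← Finset.prod_mul_prod_compl T, ← Finset.prod_mul_prod_compl T, mul_left_comm,
      ← Finset.prod_mul_distrib]
    congr 1
    · exact Finset.prod_congr rfl fun i hi => by rw [if_pos hi]
    · refine Finset.prod_congr rfl fun i hi => ?_
      rw [if_neg (Finset.mem_compl.1 hi), ← pow_add]
      congr 1
      have := hv i
      rw [mul_add]
      omega
  · intro i
    have := hv i
    rw [mul_add]
    split_ifs <;> omega
  · rw [← Finset.sum_add_sum_compl T, Finset.sum_congr rfl (g := fun i => m * b + v i) fun i hi => by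
      rw [if_pos hi], Finset.sum_congr (s₁ := Tᶜ) rfl (g := fun _ => m * (b + 1)) fun i hi => by
      rw [if_neg (Finset.mem_compl.1 hi)], Finset.sum_add_distrib]
    have h3 := T.card_add_card_compl
    rw [Fintype.card_fin] at h3
    simp only [Finset.sum_const, smul_eq_mul]
    have h4 : T.card * m + m ≤ ∑ i ∈ T, v i + h * m := by
      rcases hcard.eq_or_lt with heq | hlt
      · have := hsum T heq
        rw [heq]; omega
      · have := Nat.mul_le_mul_right m (Nat.succ_le_of_lt hlt)
        rw [Nat.succ_mul] at this
        omega
    have h5 : m * (a + h) = m * ((b + 1) * (T.card + Tᶜ.card) + 1) := by rw [ha, h3]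
    nlinarith

end Upper

section Lower

theorem exists_homogeneous_of_sub_mul_mem {A : Type*} [CommRing A] {σ : Type*} [SetLike σ A]
    [AddSubgroupClass σ A] (𝒜 : ℕ → σ) [GradedRing 𝒜] {J : Ideal A} (hJ : J.IsHomogeneous 𝒜)
    {D e : ℕ} {F g y : A} (hF : F ∈ 𝒜 D) (hg : g ∈ 𝒜 e) (hgJ : g ∉ J) (h : g - F * y ∈ J) :
    D ≤ e ∧ ∃ z ∈ 𝒜 (e - D), g - F * z ∈ J := by
  have h1 : (DirectSum.decompose 𝒜 (g - F * y) e : A) ∈ J := hJ e h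
  rw [DirectSum.decompose_sub, DirectSum.sub_apply, AddSubgroupClass.coe_sub,
    DirectSum.decompose_of_mem_same 𝒜 hg] at h1
  by_cases hDe : D ≤ e
  · rw [DirectSum.coe_decompose_mul_of_left_mem_of_le 𝒜 hF hDe] at h1
    exact ⟨hDe, _, SetLike.coe_mem _, h1⟩
  · rw [DirectSum.coe_decompose_mul_of_left_mem_of_not_le 𝒜 hF hDe, sub_zero] at h1
    exact absurd h1 hgJ

theorem mem_sup_span_prod {R : Type*} [CommRing R] {s h : ℕ} {f : Fin s → R}
    (hf : IsGenericMod f ⊥ Finset.univ (h + 1)) {S : Finset (Fin s)} (hS : S.card < h) {g : R}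
    (hg : ∀ i ∉ S, g ∈ Ideal.span (f '' (insert i S : Finset (Fin s)))) (V : Finset (Fin s))
    (hV : Disjoint S V) : ∃ y, g - (∏ i ∈ V, f i) * y ∈ Ideal.span (f '' S) := by
  induction V using Finset.induction_on with
  | empty => exact ⟨g, by simp⟩
  | insert i V hi ih =>
    rw [Finset.disjoint_insert_right] at hV
    obtain ⟨y, hy⟩ := ih hV.2
    have hle : Ideal.span (f '' S) ≤ Ideal.span (f '' (insert i S : Finset (Fin s))) :=
      Ideal.span_mono (Set.image_mono (by simp))
    have h1 : (∏ i ∈ V, f i) * y ∈ Ideal.span (f '' (insert i S : Finset (Fin s))) := by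
      have := sub_mem (hg i hV.1) (hle hy)
      rwa [sub_sub_cancel] at this
    have h2 : y ∈ Ideal.span (f '' (insert i S : Finset (Fin s))) := by
      refine IsRegularMod.prod (fun j hj => ?_) y h1
      refine isRegularMod_span_image hf ((Finset.card_insert_le _ _).trans hS) ?_
      rw [Finset.mem_insert, not_or]
      exact ⟨ne_of_mem_of_not_mem hj hi, Finset.disjoint_right.1 hV.2 hj⟩
    rw [Finset.coe_insert, Set.image_insert_eq, Ideal.mem_span_insert] at h2
    obtain ⟨c, z, hz, rfl⟩ := h2
    refine ⟨c, ?_⟩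
    rw [Finset.prod_insert hi]
    convert add_mem hy (Ideal.mul_mem_left _ (∏ i ∈ V, f i) hz) using 1
    ring

theorem mul_card_mul_le_of_mem_sup_span_pow {A : Type*} [CommRing A] {σ : Type*} [SetLike σ A]
    [AddSubgroupClass σ A] (𝒜 : ℕ → σ) [GradedRing 𝒜] {s h d : ℕ} {f : Fin s → A}
    (hd : 0 < d) (hfd : ∀ i, f i ∈ 𝒜 d) (hf : IsGenericMod f ⊥ Finset.univ (h + 1))
    (hs : h + 1 ≤ s) (k : ℕ) {S : Finset (Fin s)} (hS : S.card + k = h) {w e : ℕ} {g : A}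
    (hg : g ∈ 𝒜 e) (hgS : g ∉ Ideal.span (f '' S))
    (hgT : ∀ T : Finset (Fin s), Disjoint S T → T.card = k →
      g ∈ Ideal.span (f '' S) ⊔ Ideal.span (f '' T) ^ w) :
    d * Sᶜ.card * w ≤ e * k := by
  induction k generalizing S w e g with
  | zero =>
    have h1 := hgT ∅ (by simp) (by simp)
    rcases w with _ | w
    · simp
    · rw [Finset.coe_empty, Set.image_empty, Ideal.span_empty, Ideal.bot_pow w.succ_ne_zero,
        sup_bot_eq] at h1
      exact absurd h1 hgS
  | succ k ihk =>
    have hcS := S.card_add_card_compl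
    rw [Fintype.card_fin] at hcS
    induction w using Nat.strong_induction_on generalizing e g with
    | _ w ihw =>
    rcases Nat.eq_zero_or_pos w with rfl | hw
    · simp
    by_cases hex : ∃ i ∉ S, g ∉ Ideal.span (f '' (insert i S : Finset (Fin s)))
    · obtain ⟨i, hiS, hgi⟩ := hex
      have hci : (insert i S).card = S.card + 1 := Finset.card_insert_of_notMem hiS
      have h1 := ihk (S := insert i S) (w := w) (by omega) hg hgi fun T hT hTk => ?_
      · have hci' := (insert i S).card_add_card_compl
        rw [Fintype.card_fin, hci] at hci'
        obtain ⟨M, hM⟩ : ∃ M, Sᶜ.card = M + 1 := ⟨Sᶜ.card - 1, by omega⟩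
        have hM' : (insert i S)ᶜ.card = M := by omega
        rw [hM'] at h1
        rw [hM]
        have hkM : k + 1 ≤ M := by omega
        rcases k with _ | k
        · have : 0 < d * M * w := Nat.mul_pos (Nat.mul_pos hd (by omega)) hw
          omega
        · refine Nat.le_of_mul_le_mul_left (c := k + 1) ?_ k.succ_pos
          have h2 := Nat.mul_le_mul_left (k + 1 + 1) h1
          have h3 := Nat.mul_le_mul_left (d * w) hkM
          nlinarith
      · rw [Finset.disjoint_insert_left] at hT
        have h2 := hgT (insert i T) (Finset.disjoint_insert_right.2 ⟨hiS, hT.2⟩)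
          (by rw [Finset.card_insert_of_notMem hT.1, hTk])
        rw [← cappedIdeal_eq_sup_span_pow (b := fun _ => w) fun _ _ => le_rfl] at h2
        have h3 := cappedIdeal_le_sup_span_erase (Finset.mem_insert_self i T) h2
        rw [Finset.erase_insert hT.1, cappedIdeal_eq_sup_span_pow fun _ _ => le_rfl] at h3
        rwa [Finset.coe_insert, Set.image_insert_eq, Ideal.span_insert, sup_comm (Ideal.span _)]
    · push Not at hex
      obtain ⟨y, hy⟩ := mem_sup_span_prod hf (by omega) hex Sᶜ disjoint_compl_right
      have hJ : (Ideal.span (f '' S)).IsHomogeneous 𝒜 := by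
        refine Ideal.homogeneous_span _ _ ?_
        rintro _ ⟨i, -, rfl⟩
        exact ⟨d, hfd i⟩
      have hF : ∏ i ∈ Sᶜ, f i ∈ 𝒜 (∑ _i ∈ Sᶜ, d) :=
        SetLike.prod_mem_graded 𝒜 (fun _ => d) f fun i _ => hfd i
      rw [Finset.sum_const, smul_eq_mul] at hF
      obtain ⟨hDe, z, hz, hgz⟩ := exists_homogeneous_of_sub_mul_mem 𝒜 hJ hF hg hgS hy
      have hzS : z ∉ Ideal.span (f '' S) := fun hzS => hgS <| by
        simpa using add_mem hgz (Ideal.mul_mem_left _ (∏ i ∈ Sᶜ, f i) hzS)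
      have h1 := ihw (w - (k + 1)) (by omega) hz hzS fun T hT hTk => ?_
      · obtain ⟨e', rfl⟩ := Nat.exists_eq_add_of_le hDe
        rw [Nat.add_sub_cancel_left] at h1
        rcases le_total w (k + 1) with hwk | hwk
        · have := Nat.mul_le_mul_left (d * Sᶜ.card) hwk
          nlinarith
        · obtain ⟨w', rfl⟩ := Nat.exists_eq_add_of_le hwk
          rw [Nat.add_sub_cancel_left] at h1
          nlinarith
      · have hfT : IsGenericMod f (Ideal.span (f '' S)) T T.card := by
          have := (hf.mono le_rfl (show S.card + T.card ≤ h + 1 by omega)).sup_span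
            (Finset.subset_univ S) le_rfl (Finset.subset_univ T) hT
          rwa [bot_sup_eq] at this
        have h2 : (∏ i ∈ T, f i) * ((∏ i ∈ Sᶜ \ T, f i) * z) ∈
            Ideal.span (f '' S) ⊔ Ideal.span (f '' T) ^ w := by
          rw [← mul_assoc, mul_comm (∏ i ∈ T, f i), Finset.prod_sdiff
            (Finset.subset_compl_iff_disjoint_left.2 hT)]
          have := sub_mem (hgT T hT hTk) (Ideal.mem_sup_left hgz)
          rwa [sub_sub_cancel] at this
        have h3 := mem_sup_span_pow_of_prod_mul_mem hfT T le_rfl h2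
        rw [hTk] at h3
        refine IsRegularMod.prod (fun i hi => isRegularMod_sup_span_pow hfT ?_) z h3
        rw [← Ideal.span_union, ← Set.image_union, ← Finset.coe_union]
        rw [Finset.mem_sdiff, Finset.mem_compl] at hi
        refine isRegularMod_span_image hf ?_ (by simp [hi.1, hi.2])
        have := Finset.card_union_le S T
        omega

end Lower

section Demailly

theorem exists_weight {s h m : ℕ} (hh : 0 < h) (hs : h ≤ s) (hm : 0 < m) :
    ∃ (v : Fin s → ℕ) (Q k : ℕ), h * Q = m + k ∧ k < h ∧ ∑ i, v i + k = s * Q ∧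
      (∀ i, v i ≤ m) ∧ ∀ T : Finset (Fin s), T.card = h → m ≤ ∑ i ∈ T, v i := by
  obtain ⟨Q, k, hQk, hk⟩ : ∃ Q k, h * Q = m + k ∧ k < h := by
    refine ⟨(m + h - 1) / h, h - 1 - (m + h - 1) % h, ?_, by omega⟩
    have h1 := Nat.div_add_mod (m + h - 1) h
    have h2 := Nat.mod_lt (m + h - 1) hh
    omega
  have hQ0 : 0 < Q := Nat.pos_of_ne_zero fun hQ => by simp [hQ] at hQk; omega
  have hQm : Q ≤ m := by nlinarith
  have hsum : ∀ T : Finset (Fin s),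
      ∑ i ∈ T, (if i.val < k then Q - 1 else Q) + (T.filter fun i => i.val < k).card =
        T.card * Q := fun T => by
    rw [Finset.card_filter, ← Finset.sum_add_distrib, ← smul_eq_mul, ← Finset.sum_const]
    refine Finset.sum_congr rfl fun i _ => ?_
    split_ifs <;> omega
  have hcard : (Finset.univ.filter fun i : Fin s => i.val < k).card = k := by
    rw [Fin.card_filter_val_lt]
    omega
  refine ⟨fun i => if i.val < k then Q - 1 else Q, Q, k, hQk, hk, ?_, fun i => ?_,
    fun T hT => ?_⟩
  · simpa [hcard] using hsum Finset.univ
  · dsimp only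
    split_ifs <;> omega
  · have h1 := hsum T
    have h2 := Finset.card_le_card
      (Finset.filter_subset_filter (fun i : Fin s => i.val < k) T.subset_univ)
    rw [hT] at h1
    dsimp only
    omega

variable {K : Type*} [Field K] {n s a b d h : ℕ} {f : Fin s → MvPolynomial (Fin n) K}

theorem exists_isHomogeneous_mem_symbolicPower (hf : IsGenericMod f ⊥ Finset.univ (h + 1))
    (hne : ∀ i, f i ≠ 0) (hhom : ∀ i, (f i).IsHomogeneous d) (hb : 0 < b)
    (ha : a + h = b * s + 1) (hh : 0 < h) (hs : h ≤ s) {m : ℕ} (hm : 0 < m) :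
    ∃ Q k e, h * Q = m + k ∧ k < h ∧ e + d * k = d * (s * (m * (b - 1)) + s * Q) ∧
      ∃ g ∈ symbolicPower (afoldIdeal f a b) m, g ≠ 0 ∧ g.IsHomogeneous e := by
  obtain ⟨v, Q, k, hQ, hk, hv, hvm, hT⟩ := exists_weight hh hs hm
  refine ⟨Q, k, ∑ i, d * (m * (b - 1) + v i), hQ, hk, ?_, _,
    prod_mem_symbolicPower hf hb ha hvm hT,
    Finset.prod_ne_zero_iff.2 fun i _ => pow_ne_zero _ (hne i),
    IsHomogeneous.prod _ _ _ fun i _ => (hhom i).pow _⟩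
  rw [← Finset.mul_sum, Finset.sum_add_distrib, Finset.sum_const, Finset.card_univ,
    Fintype.card_fin, smul_eq_mul, ← hv]
  ring

theorem mul_le_homAlpha_mul (hf : IsGenericMod f ⊥ Finset.univ (h + 1))
    (hne : ∀ i, f i ≠ 0) (hhom : ∀ i, (f i).IsHomogeneous d) (hd : 0 < d) (hb : 0 < b)
    (ha : a + h = b * s + 1) (ha0 : 0 < a) (hh : 0 < h) (hs : h + 1 ≤ s) {l : ℕ} (hl : 0 < l) :
    d * s * (l * ((b - 1) * h + 1)) ≤ homAlpha (symbolicPower (afoldIdeal f a b) l) * h := by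
  obtain ⟨-, -, e, -, -, -, he⟩ :=
    exists_isHomogeneous_mem_symbolicPower hf hne hhom hb ha hh (by omega) hl
  obtain ⟨g, hg, hg0, hge⟩ := Nat.sInf_mem
    (s := {e | ∃ g ∈ symbolicPower (afoldIdeal f a b) l, g ≠ 0 ∧ g.IsHomogeneous e}) ⟨e, he⟩
  let _ : GradedRing (homogeneousSubmodule (Fin n) K) := MvPolynomial.gradedAlgebra
  have key := mul_card_mul_le_of_mem_sup_span_pow (homogeneousSubmodule (Fin n) K) hd
    (fun i => (mem_homogeneousSubmodule d (f i)).2 (hhom i)) hf hs h (S := ∅)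
    (w := l * ((b - 1) * h + 1)) (by simp) ((mem_homogeneousSubmodule _ g).2 hge)
    (by simpa using hg0)
    fun T _ hT => Ideal.mem_sup_right (symbolicPower_afoldIdeal_le_span_pow hf hb ha ha0 hT l hg)
  rw [Finset.compl_empty, Finset.card_univ, Fintype.card_fin] at key
  exact key

end Demailly

/-- The Demailly-like bound
`α(I^{(ℓ)})/ℓ ≥ (α(I^{(m)}) + h - 1)/(m + h - 1)` holds for the generalized star
configuration ideal `I = I_a(F^b)` of an `h`-generic set of `s` forms of degree `d`. -/
theorem genStarConfig_demailly {K : Type*} [Field K] [Infinite K]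
    (n s a b d : ℕ) (hs : 0 < s) (ha : 0 < a) (hb0 : 0 < b) (hd : 0 < d)
    (ha1 : (b - 1) * s + 1 < a) (ha2 : a ≤ b * s)
    (h : ℕ) (hh : h = b * s - a + 1) (hn : h ≤ n)
    (f : Fin s → MvPolynomial (Fin (n + 1)) K)
    (hinj : Function.Injective f) (hne : ∀ i, f i ≠ 0)
    (hhom : ∀ i, (f i).IsHomogeneous d)
    (hgen : ∀ l : List (Fin s), l.Nodup → l.length ≤ h + 1 →
      RingTheory.Sequence.IsRegular (MvPolynomial (Fin (n + 1)) K) (l.map f))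
    (l m : ℕ) (hl : 0 < l) (hm : 0 < m) :
    ((homAlpha (symbolicPower (afoldIdeal f a b) m) : ℚ) + h - 1) / (m + h - 1) ≤
      (homAlpha (symbolicPower (afoldIdeal f a b) l) : ℚ) / l := by
  obtain ⟨c, rfl⟩ : ∃ c, b = c + 1 := ⟨b - 1, by omega⟩
  have hh0 : 0 < h := by omega
  have hab : a + h = (c + 1) * s + 1 := by omega
  have hhs : h + 1 ≤ s := by
    rw [Nat.add_sub_cancel] at ha1
    have : (c + 1) * s = c * s + s := by ring
    omega
  have hf := isGenericMod_of_isRegular hgen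
  have lower := mul_le_homAlpha_mul hf hne hhom hd hb0 hab ha hh0 hhs hl
  obtain ⟨Q, k, e, hQ, hk, he, hmem⟩ :=
    exists_isHomogeneous_mem_symbolicPower hf hne hhom hb0 hab hh0 (by omega) hm
  have upper : homAlpha (symbolicPower (afoldIdeal f a (c + 1)) m) ≤ e := Nat.sInf_le hmem
  rw [Nat.add_sub_cancel] at lower he
  generalize homAlpha (symbolicPower (afoldIdeal f a (c + 1)) m) = A at upper ⊢
  generalize homAlpha (symbolicPower (afoldIdeal f a (c + 1)) l) = B at lower ⊢
  obtain ⟨t, rfl⟩ : ∃ t, h = k + 1 + t := ⟨h - (k + 1), by omega⟩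
  obtain ⟨r, rfl⟩ : ∃ r, s = k + 1 + t + 1 + r := ⟨s - (k + 1 + t + 1), by omega⟩
  obtain ⟨p, rfl⟩ : ∃ p, d = p + 1 := ⟨d - 1, by omega⟩
  have hm' : (0 : ℚ) < m := by exact_mod_cast hm
  have hl' : (0 : ℚ) < l := by exact_mod_cast hl
  have hQ' : ((k : ℚ) + 1 + t) * Q = m + k := by exact_mod_cast hQ
  have hH : (0 : ℚ) < k + 1 + t := by positivity
  set X : ℚ := (p + 1) * (k + 1 + t + 1 + r) * (c * (k + 1 + t) + 1) / (k + 1 + t) with hX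
  have hXB : X ≤ B / l := by
    rw [hX, div_le_div_iff₀ hH hl']
    have : ((p : ℚ) + 1) * (k + 1 + t + 1 + r) * (l * (c * (k + 1 + t) + 1)) ≤
        B * (k + 1 + t) := by exact_mod_cast lower
    linarith
  refine le_trans ?_ hXB
  have hA : (A : ℚ) + (p + 1) * k ≤
      (p + 1) * ((k + 1 + t + 1 + r) * (m * c) + (k + 1 + t + 1 + r) * Q) := by
    exact_mod_cast (Nat.add_le_add_right upper _).trans_eq he
  have hden : (0 : ℚ) < m + ((k + 1 + t : ℕ) : ℚ) - 1 := by
    push_cast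
    have : (0 : ℚ) ≤ k + t := by positivity
    linarith
  rw [hX, div_le_div_iff₀ hden hH]
  push_cast
  have h1 := mul_le_mul_of_nonneg_right hA hH.le
  have h2 : (0 : ℚ) ≤ (p + 1) * (k + 1 + t + 1 + r) * (c * (k + 1 + t) * (k + t) + t)
      + (p + 1) * k * (k + 1 + t) - (k + 1 + t) * (k + t) := by
    ring_nf
    positivity
  have h3 : ((p : ℚ) + 1) * ((k + 1 + t + 1 + r) * (m * c) + (k + 1 + t + 1 + r) * Q)
      * (k + 1 + t) = (p + 1) * (k + 1 + t + 1 + r) * (m * c * (k + 1 + t) + (m + k)) := by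
    rw [← hQ']
    ring
  rw [h3] at h1
  linarith
end

section
/- Fix a positive integer m, and for 0 ≤ j ≤ h−c_0 set K_j = ⋂_{c=c_0}^{h−j} I_{c,F}^{(m·μ̂_c)}, with K_{h−c_0+1} = R. If K_{j+1} ≠ K_j for some 0 ≤ j ≤ h−c_0, then dim R − dim(K_{j+1}/K_j) = h − j, where the dimension of a finitely generated R-module M is the Krull dimension of R/Ann_R(M). -/
open MvPolynomial

/-- The star configuration ideal of codimension `c`:
`I_{c,F} = ⋂_{i₁ < ⋯ < i_c} ⟨f_{i₁}, …, f_{i_c}⟩`. -/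
noncomputable def starConfigIdeal {R : Type*} [CommRing R] {s : ℕ} (f : Fin s → R) (c : ℕ) :
    Ideal R :=
  ⨅ (T : Finset (Fin s)) (_ : T.card = c), Ideal.span (f '' (T : Set (Fin s)))

namespace NagataSubstitution

open Polynomial MvPolynomial

variable {k : Type*} [Field k] {n : ℕ}

/-- The substitution `X_0 ↦ X_0`, `X_i ↦ X_i + c X_0 ^ (N ^ i)` for `i ≠ 0`. -/
noncomputable def hom (N : ℕ) (c : k) :
    MvPolynomial (Fin (n + 1)) k →ₐ[k] MvPolynomial (Fin (n + 1)) k :=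
  aeval fun i ↦ if i = 0 then X 0 else X i + c • X 0 ^ N ^ i.1

lemma hom_comp_hom_neg (N : ℕ) (c : k) :
    (hom N c).comp (hom N (-c)) = AlgHom.id k (MvPolynomial (Fin (n + 1)) k) := by
  rw [hom, hom, comp_aeval, ← MvPolynomial.aeval_X_left]
  ext i v
  cases i using Fin.cases <;> simp

/-- The substitution `hom N 1` as an automorphism. -/
noncomputable def equiv (N : ℕ) :
    MvPolynomial (Fin (n + 1)) k ≃ₐ[k] MvPolynomial (Fin (n + 1)) k :=
  AlgEquiv.ofAlgHom (hom N 1) (hom N (-1))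
    (hom_comp_hom_neg N 1) (by simpa using hom_comp_hom_neg N (-1 : k))

lemma finSuccEquiv_equiv_X (N : ℕ) (i : Fin (n + 1)) :
    finSuccEquiv k n (equiv N (X i)) =
      if h : i = 0 then Polynomial.X
      else Polynomial.X ^ N ^ i.1 + Polynomial.C (X (i.pred h)) := by
  cases i using Fin.cases with
  | zero => simp [equiv, hom, finSuccEquiv_X_zero]
  | succ i => simp [equiv, hom, finSuccEquiv_X_zero, finSuccEquiv_X_succ, add_comm]

lemma monic_finSuccEquiv_equiv_X {N : ℕ} (hN : N ≠ 0) (i : Fin (n + 1)) :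
    (finSuccEquiv k n (equiv N (X i))).Monic := by
  rw [finSuccEquiv_equiv_X]
  split_ifs with h
  · exact monic_X
  · exact monic_X_pow_add_C _ (pow_ne_zero _ hN)

lemma natDegree_finSuccEquiv_equiv_X (N : ℕ) (i : Fin (n + 1)) :
    (finSuccEquiv k n (equiv N (X i))).natDegree = N ^ i.1 := by
  rw [finSuccEquiv_equiv_X]
  split_ifs with h
  · simp [h]
  · exact natDegree_X_pow_add_C

lemma finSuccEquiv_equiv_monomial (N : ℕ) (v : Fin (n + 1) →₀ ℕ) (a : k) :
    finSuccEquiv k n (equiv N (monomial v a)) =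
      Polynomial.C (MvPolynomial.C a) * ∏ i, finSuccEquiv k n (equiv N (X i)) ^ v i := by
  rw [monomial_eq, Finsupp.prod_pow, map_mul, map_mul, map_prod, map_prod]
  simp only [map_pow]
  congr 1
  rw [← MvPolynomial.algebraMap_eq, AlgEquiv.commutes, AlgEquiv.commutes]
  rfl

lemma monic_prod {N : ℕ} (hN : N ≠ 0) (v : Fin (n + 1) →₀ ℕ) :
    (∏ i, finSuccEquiv k n (equiv N (X i)) ^ v i).Monic :=
  monic_prod_of_monic _ _ fun i _ ↦ (monic_finSuccEquiv_equiv_X hN i).pow _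

lemma leadingCoeff_finSuccEquiv_equiv_monomial {N : ℕ} (hN : N ≠ 0) (v : Fin (n + 1) →₀ ℕ)
    (a : k) :
    (finSuccEquiv k n (equiv N (monomial v a))).leadingCoeff = MvPolynomial.C a := by
  rw [finSuccEquiv_equiv_monomial, (monic_prod hN v).leadingCoeff_C_mul]

lemma natDegree_finSuccEquiv_equiv_monomial {N : ℕ} (hN : N ≠ 0) (v : Fin (n + 1) →₀ ℕ)
    {a : k} (ha : a ≠ 0) :
    (finSuccEquiv k n (equiv N (monomial v a))).natDegree = ∑ i : Fin (n + 1), N ^ i.1 * v i := by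
  rw [finSuccEquiv_equiv_monomial, natDegree_C_mul (by simpa using ha),
    natDegree_prod_of_monic _ _ fun i _ ↦ (monic_finSuccEquiv_equiv_X hN i).pow _]
  exact Finset.sum_congr rfl fun i _ ↦ by
    rw [(monic_finSuccEquiv_equiv_X hN i).natDegree_pow, natDegree_finSuccEquiv_equiv_X, mul_comm]

lemma eq_of_sum_pow_mul_eq {N : ℕ} (hN : 1 < N) {v w : Fin (n + 1) →₀ ℕ}
    (hv : ∀ i, v i < N) (hw : ∀ i, w i < N)
    (h : ∑ i : Fin (n + 1), N ^ i.1 * v i = ∑ i : Fin (n + 1), N ^ i.1 * w i) : v = w := by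
  refine Finsupp.ext <| congrFun <| List.ofFn_inj.mp ?_
  apply Nat.ofDigits_inj_of_len_eq hN (by simp)
    (List.forall_mem_ofFn_iff.mpr hv) (List.forall_mem_ofFn_iff.mpr hw)
  simpa only [Nat.ofDigits_eq_sum_mapIdx, List.mapIdx_eq_ofFn, List.get_ofFn, List.length_ofFn,
    Fin.val_cast, mul_comm, List.sum_ofFn] using! h

/-- After a change of variables, a nonzero polynomial over a field has invertible leading
coefficient in the variable `X_0`. -/
theorem exists_isUnit_leadingCoeff {f : MvPolynomial (Fin (n + 1)) k} (hf : f ≠ 0) :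
    ∃ e : MvPolynomial (Fin (n + 1)) k ≃ₐ[k] Polynomial (MvPolynomial (Fin n) k),
      IsUnit (e f).leadingCoeff := by
  obtain ⟨N, hN⟩ : ∃ N, N = 2 + f.totalDegree := ⟨_, rfl⟩
  have hN1 : 1 < N := by omega
  have hN0 : N ≠ 0 := by omega
  refine ⟨(equiv N).trans (finSuccEquiv k n), ?_⟩
  let g (v : Fin (n + 1) →₀ ℕ) := finSuccEquiv k n (equiv N (monomial v (coeff v f)))
  have hfg : (equiv N).trans (finSuccEquiv k n) f = ∑ v ∈ f.support, g v := by
    conv_lhs => rw [← f.support_sum_monomial_coeff]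
    rw [map_sum]
    rfl
  have hlt : ∀ v ∈ f.support, ∀ i, v i < N := fun v hv i ↦
    lt_of_le_of_lt ((monomial_le_degreeOf i hv).trans (degreeOf_le_totalDegree f i)) (by omega)
  obtain ⟨v, hv, hmax⟩ := Finset.exists_max_image f.support (fun v ↦ (g v).natDegree)
    (support_nonempty.mpr hf)
  have hlead : (g v).leadingCoeff = MvPolynomial.C (coeff v f) :=
    leadingCoeff_finSuccEquiv_equiv_monomial hN0 _ _
  have hv0 : coeff v f ≠ 0 := mem_support_iff.mp hv
  have hgv : g v ≠ 0 := by
    rw [← leadingCoeff_ne_zero, hlead]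
    simpa using hv0
  have hdeg : (∑ w ∈ f.support.erase v, g w).degree < (g v).degree := by
    refine (degree_sum_le _ _).trans_lt ((Finset.sup_lt_iff (bot_lt_iff_ne_bot.mpr
      (degree_ne_bot.mpr hgv))).mpr fun w hw ↦ degree_lt_degree ?_)
    obtain ⟨hne, hw⟩ := Finset.mem_erase.mp hw
    refine lt_of_le_of_ne (hmax w hw) fun heq ↦ hne ?_
    rw [natDegree_finSuccEquiv_equiv_monomial hN0 _ (mem_support_iff.mp hw),
      natDegree_finSuccEquiv_equiv_monomial hN0 _ hv0] at heq
    exact eq_of_sum_pow_mul_eq hN1 (hlt w hw) (hlt v hv) heq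
  rw [hfg, ← Finset.sum_erase_add _ _ hv, leadingCoeff_add_of_degree_lt hdeg, hlead]
  exact hv0.isUnit.map _

end NagataSubstitution

section WeaklyRegular

open RingTheory.Sequence

/-- An injective integral ring homomorphism into a domain does not lower the Krull dimension. -/
theorem ringKrullDim_le_of_isIntegral_of_injective {R S : Type*} [CommRing R] [CommRing S]
    [IsDomain S] (f : R →+* S) (hf : f.IsIntegral) (hinj : Function.Injective f) :
    ringKrullDim R ≤ ringKrullDim S := by
  let _ : Algebra R S := f.toAlgebra
  have : Algebra.IsIntegral R S := ⟨hf⟩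
  have : Algebra.HasGoingUp R S := by
    refine ⟨fun {p} _ P _ hlt ↦ ?_⟩
    obtain ⟨Q, hQ, hQp, hQc⟩ :=
      Ideal.exists_ideal_over_prime_of_isIntegral_of_isPrime p P hlt.le
    exact ⟨Q, hQ, hQp, ⟨hQc.symm⟩⟩
  refine iSup_le fun l ↦ ?_
  obtain ⟨P, -, hP, hPc⟩ := Ideal.exists_ideal_over_prime_of_isIntegral_of_isPrime (S := S)
    l.head.asIdeal ⊥ (by
      change RingHom.ker f ≤ _
      rw [(RingHom.injective_iff_ker_eq_bot f).mp hinj]; exact bot_le)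
  have : P.LiesOver l.head.asIdeal := ⟨hPc.symm⟩
  obtain ⟨L, hL, -⟩ := Ideal.exists_ltSeries_of_hasGoingUp l P
  rw [← hL]
  exact Order.LTSeries.length_le_krullDim L

open scoped Polynomial in
/-- A weakly regular sequence of coefficients followed by a monic polynomial is weakly regular. -/
theorem isWeaklyRegular_map_C_append_monic {R : Type*} [CommRing R] {rs : List R}
    (hrs : IsWeaklyRegular R rs) {g : R[X]} (hg : g.Monic) :
    IsWeaklyRegular R[X] (rs.map Polynomial.C ++ [g]) := by
  rw [isWeaklyRegular_append_iff]
  refine ⟨hrs.of_flat (S := R[X]), ?_⟩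
  rw [isWeaklyRegular_singleton_iff, isSMulRegular_iff_right_eq_zero_of_smul]
  intro x hx
  obtain ⟨x, rfl⟩ := Submodule.Quotient.mk_surjective _ x
  rw [← Submodule.Quotient.mk_smul, Submodule.Quotient.mk_eq_zero, smul_eq_mul, ← Ideal.map_ofList,
    smul_eq_mul, Ideal.mul_top, Ideal.mem_map_C_iff] at hx
  rw [Submodule.Quotient.mk_eq_zero, ← Ideal.map_ofList, smul_eq_mul, Ideal.mul_top]
  have key (y : R[X]) : y ∈ Ideal.map Polynomial.C (Ideal.ofList rs) ↔
      y.map (Ideal.Quotient.mk (Ideal.ofList rs)) = 0 := by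
    rw [← Polynomial.coe_mapRingHom, ← RingHom.mem_ker, Polynomial.ker_mapRingHom, Ideal.mk_ker]
  rw [← Ideal.mem_map_C_iff, key, Polynomial.map_mul] at hx
  rw [key]
  exact (hg.map _).mul_right_eq_zero_iff.mp hx

/-- The quotient of a ring by a weakly regular sequence of length `r` has dimension at most
`dim R - r`. -/
theorem ringKrullDim_quotient_add_length_le {R : Type*} [CommRing R] {rs : List R}
    (hrs : IsWeaklyRegular R rs) :
    ringKrullDim (R ⧸ Ideal.ofList rs) + rs.length ≤ ringKrullDim R := by
  induction rs using List.reverseRecOn with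
  | nil => simpa using ringKrullDim_quotient_le (Ideal.ofList ([] : List R))
  | append_singleton rs r ih =>
    rw [isWeaklyRegular_append_iff, isWeaklyRegular_singleton_iff, smul_eq_mul,
      Ideal.mul_top] at hrs
    obtain ⟨h1, h2⟩ := hrs
    refine le_trans ?_ (ih h1)
    have hle : Ideal.ofList rs ≤ Ideal.ofList (rs ++ [r]) := by
      rw [Ideal.ofList_append]; exact le_sup_left
    have := ringKrullDim_succ_le_of_surjective (Ideal.Quotient.factor hle)
      (Ideal.Quotient.factor_surjective hle) (r := Ideal.Quotient.mk _ r) ?_ ?_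
    · rw [List.length_append, List.length_singleton, add_comm rs.length, Nat.cast_add,
        Nat.cast_one, ← add_assoc]
      gcongr
    · rw [mem_nonZeroDivisors_iff_left]
      intro x hx
      exact (isSMulRegular_iff_right_eq_zero_of_smul.mp h2) x hx
    · rw [Ideal.Quotient.factor_mk, Ideal.Quotient.eq_zero_iff_mem]
      exact Ideal.subset_span (by simp)

open scoped Polynomial in
/-- If a prime ideal `P` of `R[X]` contains a monic polynomial, then contracting `P` to `R` does not
raise the dimension of the quotient. -/
theorem ringKrullDim_quotient_comap_C_le {R : Type*} [CommRing R] (P : Ideal R[X]) [P.IsPrime]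
    {g : R[X]} (hgP : g ∈ P) (hg : g.Monic) :
    ringKrullDim (R ⧸ P.comap Polynomial.C) ≤ ringKrullDim (R[X] ⧸ P) := by
  let φ : R ⧸ P.comap Polynomial.C →+* R[X] ⧸ P := Ideal.quotientMap P Polynomial.C le_rfl
  refine ringKrullDim_le_of_isIntegral_of_injective φ ?_ Ideal.quotientMap_injective
  refine RingHom.IsIntegral.tower_top (Ideal.Quotient.mk (P.comap Polynomial.C)) φ ?_
  rw [Ideal.quotientMap_comp_mk]
  exact hg.quotient_isIntegral hgP

/-- A prime ideal `p` of a polynomial ring over a field contains a weakly regular sequence whose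
length is at least the number of variables minus the dimension of the quotient by `p`. -/
theorem MvPolynomial.exists_isWeaklyRegular_of_isPrime {k : Type*} [Field k] (n : ℕ)
    (p : Ideal (MvPolynomial (Fin n) k)) [p.IsPrime] :
    ∃ rs : List (MvPolynomial (Fin n) k), (∀ r ∈ rs, r ∈ p) ∧
      IsWeaklyRegular (MvPolynomial (Fin n) k) rs ∧
      (n : WithBot ℕ∞) ≤ ringKrullDim (MvPolynomial (Fin n) k ⧸ p) + rs.length := by
  induction n with
  | zero => exact ⟨[], by simp, .nil _ _, by simpa using ringKrullDim_nonneg_of_nontrivial⟩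
  | succ n ih =>
    by_cases hp : p = ⊥
    · refine ⟨[], by simp, .nil _ _, ?_⟩
      subst hp
      rw [ringKrullDim_eq_of_ringEquiv (RingEquiv.quotientBot _),
        MvPolynomial.ringKrullDim_of_isNoetherianRing]
      simp
    obtain ⟨g, hgp, hg⟩ := Submodule.exists_mem_ne_zero_of_ne_bot hp
    obtain ⟨e', u, hu⟩ := NagataSubstitution.exists_isUnit_leadingCoeff hg
    let e : MvPolynomial (Fin (n + 1)) k ≃+* Polynomial (MvPolynomial (Fin n) k) := e'.toRingEquiv
    replace hu : (u : MvPolynomial (Fin n) k) = (e g).leadingCoeff := hu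
    let P := p.comap e.symm
    let q := P.comap Polynomial.C
    have hPp : P.IsPrime := Ideal.comap_isPrime _ _
    have hqp : q.IsPrime := Ideal.comap_isPrime _ _
    obtain ⟨rs, hrsq, hrs, hdim⟩ := ih q
    let G := Polynomial.C (↑u⁻¹ : MvPolynomial (Fin n) k) * e g
    have hG : G.Monic := by
      rw [Polynomial.Monic, Polynomial.leadingCoeff_mul, Polynomial.leadingCoeff_C, ← hu,
        Units.inv_mul]
    have hGP : G ∈ P := by
      refine Ideal.mul_mem_left _ _ ?_
      simpa [P, Ideal.mem_comap] using hgp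
    have hle := ringKrullDim_quotient_comap_C_le P hGP hG
    have heq : ringKrullDim (MvPolynomial (Fin (n + 1)) k ⧸ p) =
        ringKrullDim (Polynomial (MvPolynomial (Fin n) k) ⧸ P) :=
      ringKrullDim_eq_of_ringEquiv (Ideal.quotientEquiv p P e (Ideal.comap_symm e))
    rw [← heq] at hle
    refine ⟨(rs.map Polynomial.C ++ [G]).map e.symm, ?_, ?_, ?_⟩
    · intro r hr
      rw [List.mem_map] at hr
      obtain ⟨x, hx, rfl⟩ := hr
      change x ∈ P
      rw [List.mem_append, List.mem_map, List.mem_singleton] at hx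
      rcases hx with ⟨y, hy, rfl⟩ | rfl
      · exact hrsq y hy
      · exact hGP
    · refine (AddEquiv.isWeaklyRegular_congr (e := e.symm.toAddEquiv) ?_).mp
        (isWeaklyRegular_map_C_append_monic hrs hG)
      exact List.forall₂_map_right_iff.mpr <| List.forall₂_same.mpr fun r _ x ↦ map_mul e.symm r x
    · simp only [List.length_map, List.length_append, List.length_singleton, Nat.cast_add,
        Nat.cast_one, ← add_assoc]
      gcongr
      exact hdim.trans (by gcongr)

section Ext

open CategoryTheory Abelian Limits

universe u

/-- If `Ext^i(N, M)` vanishes for all `i` up to the length of an `M`-regular sequence `rs`, then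
every linear map from `N` to `M ⧸ rs M` vanishes. -/
theorem subsingleton_linearMap_quotient_of_subsingleton_ext {R : Type u} [CommRing R]
    (N M : ModuleCat.{u} R) {rs : List R} (hrs : IsWeaklyRegular M rs)
    (h : ∀ i ≤ rs.length, Subsingleton (Ext N M i)) :
    Subsingleton (N →ₗ[R] (M ⧸ (Ideal.ofList rs • ⊤ : Submodule R M))) := by
  induction rs generalizing M with
  | nil =>
    have := h 0 le_rfl
    have : Subsingleton (N →ₗ[R] M) :=
      (Ext.addEquiv₀.trans ModuleCat.homAddEquiv).symm.subsingleton
    have e : (M ⧸ (Ideal.ofList ([] : List R) • ⊤ : Submodule R M)) ≃ₗ[R] M :=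
      Submodule.quotEquivOfEqBot _ (by simp)
    exact (LinearEquiv.congrRight (M := N) e).toEquiv.subsingleton
  | cons r rs ih =>
    rw [isWeaklyRegular_cons_iff] at hrs
    have := ih (ModuleCat.of R (QuotSMulTop r M)) hrs.2 fun i hi ↦ by
      have h₁ := AddCommGrpCat.isZero_of_iff_subsingleton.mpr
        (h i (hi.trans (Nat.le_succ _)))
      have h₂ := AddCommGrpCat.isZero_of_iff_subsingleton.mpr (h (i + 1) (Nat.succ_le_succ hi))
      exact AddCommGrpCat.subsingleton_of_isZero <| ShortComplex.Exact.isZero_of_both_zeros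
        ((Ext.covariant_sequence_exact₃' N hrs.1.smulShortComplex_shortExact) i (i + 1) rfl)
        (h₁.eq_zero_of_src _) (h₂.eq_zero_of_tgt _)
    exact (LinearEquiv.congrRight (M := N)
      (Submodule.quotOfListConsSMulTopEquivQuotSMulTopInner M r rs)).toEquiv.subsingleton

/-- If an ideal `p` kills a nonzero element modulo a weakly regular sequence `fs`, then no weakly
regular sequence in `p` is longer than `fs`. -/
theorem length_le_length_of_isWeaklyRegular {R : Type u} [CommRing R] [IsNoetherianRing R]
    {p : Ideal R} (hp : p ≠ ⊤) {rs fs : List R} (hrs : IsWeaklyRegular R rs)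
    (hmem : ∀ r ∈ rs, r ∈ p) (hfs : IsWeaklyRegular R fs) {x : R} (hx : x ∉ Ideal.ofList fs)
    (hpx : ∀ r ∈ p, r * x ∈ Ideal.ofList fs) : rs.length ≤ fs.length := by
  by_contra! hlt
  have hle : Ideal.ofList rs ≤ p := Ideal.span_le.mpr hmem
  have hreg : IsRegular R rs := ⟨hrs, by
    rw [smul_eq_mul, Ideal.mul_top]
    exact (ne_top_of_le_ne_top hp hle).symm⟩
  have hext := ModuleCat.subsingleton_ext_of_exists_isRegular p (ModuleCat.of R (R ⧸ p))
    (by rw [Module.support_eq_zeroLocus, Ideal.annihilator_quotient]) (ModuleCat.of R R)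
    (by simpa using hp.lt_top) rs hmem hreg
  have := subsingleton_linearMap_quotient_of_subsingleton_ext (ModuleCat.of R (R ⧸ p))
    (ModuleCat.of R R) hfs fun i hi ↦ hext i (hi.trans_lt hlt)
  let φ : R ⧸ p →ₗ[R] R ⧸ (Ideal.ofList fs • ⊤ : Ideal R) :=
    Submodule.liftQ p (LinearMap.toSpanSingleton R _ (Submodule.Quotient.mk x)) fun r hr ↦ by
      rw [LinearMap.mem_ker, LinearMap.toSpanSingleton_apply, ← Submodule.Quotient.mk_smul,
        Submodule.Quotient.mk_eq_zero, smul_eq_mul, smul_eq_mul, Ideal.mul_top]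
      exact hpx r hr
  have hφ : φ = 0 := this.elim φ 0
  have h1 := LinearMap.congr_fun hφ (Submodule.Quotient.mk 1)
  rw [Submodule.liftQ_apply, LinearMap.toSpanSingleton_apply, one_smul, LinearMap.zero_apply,
    Submodule.Quotient.mk_eq_zero, smul_eq_mul, Ideal.mul_top] at h1
  exact hx h1

end Ext

end WeaklyRegular

theorem pow_le_symbolicPower {R : Type*} [CommRing R] (I : Ideal R) (N : ℕ) :
    I ^ N ≤ symbolicPower I N :=
  le_iInf₂ fun _ _ ↦ Ideal.le_comap_map

/-- A multiplier of an element outside a symbolic power into that symbolic power lies in an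
associated prime that does not depend on the multiplier. -/
theorem exists_mem_associatedPrimes_of_notMem_symbolicPower {R : Type*} [CommRing R]
    {I : Ideal R} {N : ℕ} {x : R} (hx : x ∉ symbolicPower I N) :
    ∃ p ∈ associatedPrimes R (R ⧸ I), ∀ r, r * x ∈ symbolicPower I N → r ∈ p := by
  simp only [symbolicPower, Submodule.mem_iInf, not_forall] at hx
  obtain ⟨p, hp, hxp⟩ := hx
  have : p.IsPrime := hp.isPrime
  refine ⟨p, hp, fun r hr ↦ ?_⟩
  by_contra hrp
  simp only [symbolicPower, Submodule.mem_iInf] at hr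
  have h := hr p hp
  rw [Ideal.mem_comap, map_mul, Ideal.unit_mul_mem_iff_mem _
    (IsLocalization.map_units _ (⟨r, hrp⟩ : p.primeCompl))] at h
  exact hxp h

/-- A prime ideal containing `I_{c,F}` contains `c` of the elements of `F`. -/
theorem exists_span_le_of_starConfigIdeal_le {R : Type*} [CommRing R] {s : ℕ} {f : Fin s → R}
    {c : ℕ} {P : Ideal R} (hP : P.IsPrime) (h : starConfigIdeal f c ≤ P) :
    ∃ T : Finset (Fin s), T.card = c ∧ Ideal.span (f '' (T : Set (Fin s))) ≤ P := by
  have : (Finset.univ.filter fun T : Finset (Fin s) ↦ T.card = c).inf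
      (fun T ↦ Ideal.span (f '' (T : Set (Fin s)))) ≤ P := by
    simpa [Finset.inf_eq_iInf, starConfigIdeal] using h
  obtain ⟨T, hT, hTP⟩ := hP.inf_le'.mp this
  exact ⟨T, by simpa using hT, hTP⟩

/-- An associated prime of `R ⧸ I_{c,F}` kills a nonzero element modulo some `c` of the elements
of `F`. -/
theorem exists_notMem_span_of_mem_associatedPrimes {R : Type*} [CommRing R]
    [IsNoetherianRing R] {s : ℕ} {f : Fin s → R} {c : ℕ} {p : Ideal R}
    (hp : p ∈ associatedPrimes R (R ⧸ starConfigIdeal f c)) :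
    ∃ T : Finset (Fin s), T.card = c ∧ ∃ u, u ∉ Ideal.span (f '' (T : Set (Fin s))) ∧
      ∀ r ∈ p, r * u ∈ Ideal.span (f '' (T : Set (Fin s))) := by
  obtain ⟨hpp, x, hx⟩ := isAssociatedPrime_iff.mp hp
  obtain ⟨u, rfl⟩ := Ideal.Quotient.mk_surjective x
  have hmem (r : R) : r ∈ p ↔ r * u ∈ starConfigIdeal f c := by
    rw [hx, Submodule.mem_colon_singleton, Submodule.mem_bot,
      ← Ideal.Quotient.eq_zero_iff_mem, map_mul]
    rfl
  by_contra! H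
  have hu : u ∈ starConfigIdeal f c := by
    simp only [starConfigIdeal, Submodule.mem_iInf] at hmem ⊢
    intro T hT
    by_contra huT
    obtain ⟨r, hr, hru⟩ := H T hT u huT
    exact hru ((hmem r).mp hr T hT)
  exact hpp.ne_top ((Ideal.eq_top_iff_one p).mpr ((hmem 1).mpr (by rwa [one_mul])))

/-- If every prime ideal containing `J` contains one of a family of ideals whose quotients have
dimension at most `d`, then `R ⧸ J` has dimension at most `d`. -/
theorem ringKrullDim_quotient_le_of_forall_isPrime {R : Type*} [CommRing R] {J : Ideal R}
    {D : WithBot ℕ∞}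
    (h : ∀ P : Ideal R, P.IsPrime → J ≤ P → ∃ I ≤ P, ringKrullDim (R ⧸ I) ≤ D) :
    ringKrullDim (R ⧸ J) ≤ D := by
  rw [ringKrullDim_quotient]
  refine iSup_le fun l ↦ ?_
  obtain ⟨I, hI, hD⟩ := h l.head.1.asIdeal l.head.1.isPrime l.head.2
  refine le_trans ?_ hD
  rw [ringKrullDim_quotient]
  let L : LTSeries (PrimeSpectrum.zeroLocus (R := R) I) :=
    { length := l.length
      toFun := fun i ↦ ⟨(l i).1, hI.trans (LTSeries.head_le l i)⟩
      step := fun i ↦ l.step i }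
  exact Order.LTSeries.length_le_krullDim L

/-- The ideal of the list of values of `f` on `T` is the span of the image of `T`. -/
theorem ofList_toList_map {R : Type*} [CommRing R] {s : ℕ} (f : Fin s → R) (T : Finset (Fin s)) :
    Ideal.ofList (T.toList.map f) = Ideal.span (f '' (T : Set (Fin s))) := by
  simp [Ideal.ofList, Set.image]

/-- With `K_j = ⋂_{c=c₀}^{h-j} I_{c,F}^{(m·μ̂_c)}`, if `K_{j+1} ≠ K_j` then
`dim R - dim (K_{j+1}/K_j) = h - j`, where the dimension of a module `M` is the Krull
dimension of `R / Ann_R(M)`; equivalently `dim (K_{j+1}/K_j) + (h - j) = dim R`. -/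
theorem filtration_quotient_dim {K : Type*} [Field K] [Infinite K]
    (n s a b d : ℕ) (hs : 0 < s) (ha : 0 < a) (hb0 : 0 < b) (hd : 0 < d)
    (ha1 : (b - 1) * s + 1 < a) (ha2 : a ≤ b * s)
    (h c₀ μ₀ : ℕ) (hh : h = b * s - a + 1) (hc₀ : c₀ = s - (a - 1) / b)
    (hμ₀ : μ₀ = a - b * (s - c₀)) (hn : h ≤ n)
    (f : Fin s → MvPolynomial (Fin (n + 1)) K)
    (hinj : Function.Injective f) (hne : ∀ i, f i ≠ 0)
    (hhom : ∀ i, (f i).IsHomogeneous d)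
    (hgen : ∀ l : List (Fin s), l.Nodup → l.length ≤ h + 1 →
      RingTheory.Sequence.IsRegular (MvPolynomial (Fin (n + 1)) K) (l.map f))
    (m : ℕ) (hm : 0 < m) (j : ℕ) (hj : j ≤ h - c₀)
    (Kj Kj1 : Ideal (MvPolynomial (Fin (n + 1)) K))
    (hKj : Kj = ⨅ (c : ℕ) (_ : c₀ ≤ c) (_ : c ≤ h - j),
      symbolicPower (starConfigIdeal f c) (m * (μ₀ + b * (c - c₀))))
    (hKj1 : Kj1 = ⨅ (c : ℕ) (_ : c₀ ≤ c) (_ : c ≤ h - (j + 1)),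
      symbolicPower (starConfigIdeal f c) (m * (μ₀ + b * (c - c₀))))
    (hne' : Kj1 ≠ Kj) :
    ringKrullDim ((MvPolynomial (Fin (n + 1)) K) ⧸
        Module.annihilator (MvPolynomial (Fin (n + 1)) K)
          (↥Kj1 ⧸ Submodule.comap (Submodule.subtype Kj1) Kj)) +
      ((h - j : ℕ)) =
      ringKrullDim (MvPolynomial (Fin (n + 1)) K) := by
  set e := h - j
  set J := Module.annihilator (MvPolynomial (Fin (n + 1)) K)
    (↥Kj1 ⧸ Submodule.comap (Submodule.subtype Kj1) Kj)
  have hmemKj (x) : x ∈ Kj ↔ ∀ c, c₀ ≤ c → c ≤ e →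
      x ∈ symbolicPower (starConfigIdeal f c) (m * (μ₀ + b * (c - c₀))) := by
    simp only [hKj, Submodule.mem_iInf]
  have hmemKj1 (x) : x ∈ Kj1 ↔ ∀ c, c₀ ≤ c → c ≤ h - (j + 1) →
      x ∈ symbolicPower (starConfigIdeal f c) (m * (μ₀ + b * (c - c₀))) := by
    simp only [hKj1, Submodule.mem_iInf]
  have hJ (r) : r ∈ J ↔ ∀ x ∈ Kj1, r * x ∈ Kj := by
    rw [Module.mem_annihilator, (Submodule.Quotient.mk_surjective _).forall]
    simp only [← Submodule.Quotient.mk_smul, Submodule.Quotient.mk_eq_zero, Subtype.forall]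
    rfl
  have hreg (T : Finset (Fin s)) (hT : T.card = e) :
      RingTheory.Sequence.IsWeaklyRegular (MvPolynomial (Fin (n + 1)) K) (T.toList.map f) :=
    (hgen _ T.nodup_toList (by rw [Finset.length_toList]; omega)).toIsWeaklyRegular
  have hdim : ringKrullDim (MvPolynomial (Fin (n + 1)) K) = ((n + 1 : ℕ) : WithBot ℕ∞) := by
    simp [MvPolynomial.ringKrullDim_of_isNoetherianRing]
  have hpow : starConfigIdeal f e ^ (m * (μ₀ + b * (e - c₀))) ≤ J := fun r hr ↦
    (hJ r).mpr fun x hx ↦ (hmemKj _).mpr fun c hc hce ↦ by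
      by_cases hc' : c ≤ h - (j + 1)
      · exact Ideal.mul_mem_left _ _ ((hmemKj1 x).mp hx c hc hc')
      · obtain rfl : c = e := by omega
        exact Ideal.mul_mem_right _ _ (pow_le_symbolicPower _ _ hr)
  rw [hdim]
  apply le_antisymm
  · have key : ringKrullDim (MvPolynomial (Fin (n + 1)) K ⧸ J) ≤
        ((n + 1 - e : ℕ) : WithBot ℕ∞) := by
      refine ringKrullDim_quotient_le_of_forall_isPrime fun P hP hJP ↦ ?_
      obtain ⟨T, hT, hTP⟩ :=
        exists_span_le_of_starConfigIdeal_le hP (hP.le_of_pow_le (hpow.trans hJP))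
      refine ⟨_, hTP, ?_⟩
      have h1 := ringKrullDim_quotient_add_length_le (hreg T hT)
      rw [ofList_toList_map, List.length_map, Finset.length_toList, hT, hdim] at h1
      generalize ringKrullDim (MvPolynomial (Fin (n + 1)) K ⧸ Ideal.span (f '' ↑T)) = D at h1 ⊢
      induction D with
      | bot => exact bot_le
      | coe D =>
        induction D with
        | top => exact absurd h1 (by norm_cast)
        | coe D =>
          replace h1 : D + e ≤ n + 1 := by exact_mod_cast h1
          exact WithBot.coe_le_coe.mpr (ENat.natCast_le_natCast.mpr (Nat.le_sub_of_add_le h1))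
    calc _ ≤ ((n + 1 - e : ℕ) : WithBot ℕ∞) + (e : ℕ) := by gcongr
      _ ≤ _ := by norm_cast; omega
  · obtain ⟨x, hx1, hx⟩ : ∃ x ∈ Kj1, x ∉ Kj := by
      by_contra! H
      refine hne' (le_antisymm H fun x hx ↦ (hmemKj1 x).mpr fun c hc hce ↦ ?_)
      exact (hmemKj x).mp hx c hc (by omega)
    have hxe : x ∉ symbolicPower (starConfigIdeal f e) (m * (μ₀ + b * (e - c₀))) := fun hxe ↦
      hx <| (hmemKj x).mpr fun c hc hce ↦ by
        by_cases hc' : c ≤ h - (j + 1)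
        · exact (hmemKj1 x).mp hx1 c hc hc'
        · obtain rfl : c = e := by omega
          exact hxe
    have hce : c₀ ≤ e := by
      by_contra hce
      exact hx ((hmemKj x).mpr fun c hc hc' ↦ by omega)
    obtain ⟨p, hp, hpx⟩ := exists_mem_associatedPrimes_of_notMem_symbolicPower hxe
    have hJp : J ≤ p := fun r hr ↦ hpx r ((hmemKj _).mp ((hJ r).mp hr x hx1) e hce le_rfl)
    have hpp : p.IsPrime := hp.isPrime
    obtain ⟨T, hT, u, hu, hpu⟩ := exists_notMem_span_of_mem_associatedPrimes hp
    obtain ⟨rs, hrsp, hrs, hle⟩ := MvPolynomial.exists_isWeaklyRegular_of_isPrime (n + 1) p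
    rw [← ofList_toList_map] at hu hpu
    have hlen := length_le_length_of_isWeaklyRegular hpp.ne_top hrs hrsp (hreg T hT) hu hpu
    rw [List.length_map, Finset.length_toList, hT] at hlen
    refine hle.trans ?_
    gcongr
    exact ringKrullDim_le_of_surjective (Ideal.Quotient.factor hJp)
      (Ideal.Quotient.factor_surjective hJp)
end
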